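/- arXiv:1410.7437 — 2 statements merged into one kernel-verified Lean document; each statement's English description precedes it below -/
import Mathlib

section
/- For every positive integer v ∉ {2,6,8} there exists a pairwise balanced design PBD(v,{3,4,5}) such that every set of three points is contained in a flat of size at most 63, unless v - [e]₄ ∈ {1,3,9} for some integer e ≥ 3 (where [e]₄ := 1+4+4²+...+4ᵉ), in which case there exists a PBD(v,{3,4,5}) such that every set of three points is contained in a flat of size at most 94. -/
/-- `IsPBD V K Blocks` : the blocks form a pairwise balanced design on point set `V`
with block sizes in `K`: every block is a subset of `V` of size in `K`, and every
pair of distinct points of `V` lies in exactly one block. -/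
def IsPBD {X : Type*} (V : Finset X) (K : Set ℕ) (Blocks : Finset (Finset X)) : Prop :=
  (∀ B ∈ Blocks, B ⊆ V ∧ B.card ∈ K) ∧
    ∀ x ∈ V, ∀ y ∈ V, x ≠ y → ∃! B, B ∈ Blocks ∧ x ∈ B ∧ y ∈ B

/-- `IsFlat V Blocks Y` : `Y` is a flat of the design `(V, Blocks)`: `Y ⊆ V` and every
pair of distinct points of `Y` lies in a block entirely contained in `Y`. -/
def IsFlat {X : Type*} (V : Finset X) (Blocks : Finset (Finset X)) (Y : Finset X) : Prop :=
  Y ⊆ V ∧ ∀ x ∈ Y, ∀ y ∈ Y, x ≠ y → ∃ B ∈ Blocks, x ∈ B ∧ y ∈ B ∧ B ⊆ Y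

/-- `bracket4 e = [e]₄ = 1 + 4 + 4² + ⋯ + 4^e`. -/
def bracket4 (e : ℕ) : ℕ := ∑ i ∈ Finset.range (e + 1), 4 ^ i

/-! ### Designs in which three points generate a small flat -/

/-- There is a `PBD(v, {3,4,5})` in which any three points lie in a flat of size at most `m`. -/
def HasDesign (v m : ℕ) : Prop :=
  ∃ Blocks : Finset (Finset (Fin v)), IsPBD Finset.univ ({3, 4, 5} : Set ℕ) Blocks ∧
    ∀ S : Finset (Fin v), S.card = 3 →
      ∃ Y : Finset (Fin v), IsFlat Finset.univ Blocks Y ∧ S ⊆ Y ∧ Y.card ≤ m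

theorem HasDesign.of_isPBD {X : Type*} [DecidableEq X] {V : Finset X} {m : ℕ}
    {Blocks : Finset (Finset X)} (h : IsPBD V ({3, 4, 5} : Set ℕ) Blocks)
    (hflat : ∀ S ⊆ V, S.card = 3 → ∃ Y, IsFlat V Blocks Y ∧ S ⊆ Y ∧ Y.card ≤ m) :
    HasDesign V.card m := by
  classical
  let e : Fin V.card ≃ V := V.equivFin.symm
  let f : Fin V.card ↪ X := e.toEmbedding.trans (Function.Embedding.subtype _)
  have hfV : ∀ i, f i ∈ V := fun i => (e i).2
  have hsurj : ∀ x ∈ V, ∃ i, f i = x := fun x hx => ⟨e.symm ⟨x, hx⟩, by simp [f]⟩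
  let pull : Finset X → Finset (Fin V.card) := fun B => Finset.univ.filter (fun i => f i ∈ B)
  have hmem : ∀ B i, i ∈ pull B ↔ f i ∈ B := by simp [pull]
  have hmap : ∀ B ⊆ V, (pull B).map f = B := by
    intro B hB
    ext x
    simp only [Finset.mem_map, hmem]
    constructor
    · rintro ⟨i, hi, rfl⟩; exact hi
    · intro hx
      obtain ⟨i, rfl⟩ := hsurj x (hB hx)
      exact ⟨i, hx, rfl⟩
  have hcard : ∀ B ⊆ V, (pull B).card = B.card := fun B hB => by
    rw [← Finset.card_map f, hmap B hB]
  refine ⟨Blocks.image pull, ⟨?_, ?_⟩, ?_⟩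
  · intro B hB
    obtain ⟨C, hC, rfl⟩ := Finset.mem_image.1 hB
    exact ⟨Finset.subset_univ _, by rw [hcard C (h.1 C hC).1]; exact (h.1 C hC).2⟩
  · intro i _ j _ hij
    obtain ⟨B, ⟨hB, hiB, hjB⟩, huniq⟩ := h.2 (f i) (hfV i) (f j) (hfV j) (f.injective.ne hij)
    refine ⟨pull B, ⟨Finset.mem_image_of_mem _ hB, (hmem _ _).2 hiB, (hmem _ _).2 hjB⟩, ?_⟩
    rintro C ⟨hC, hiC, hjC⟩
    obtain ⟨C, hC', rfl⟩ := Finset.mem_image.1 hC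
    rw [huniq C ⟨hC', (hmem _ _).1 hiC, (hmem _ _).1 hjC⟩]
  · intro S hS
    obtain ⟨Y, hY, hSY, hYm⟩ := hflat (S.map f)
      (fun x hx => by obtain ⟨i, _, rfl⟩ := Finset.mem_map.1 hx; exact hfV i)
      (by rw [Finset.card_map, hS])
    refine ⟨pull Y, ⟨Finset.subset_univ _, ?_⟩, ?_, by rwa [hcard Y hY.1]⟩
    · intro i hi j hj hij
      obtain ⟨B, hB, hiB, hjB, hBY⟩ := hY.2 (f i) ((hmem _ _).1 hi) (f j) ((hmem _ _).1 hj)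
        (f.injective.ne hij)
      exact ⟨pull B, Finset.mem_image_of_mem _ hB, (hmem _ _).2 hiB, (hmem _ _).2 hjB,
        fun k hk => (hmem _ _).2 (hBY ((hmem _ _).1 hk))⟩
    · intro i hi
      exact (hmem _ _).2 (hSY (Finset.mem_map_of_mem f hi))

theorem HasDesign.self {v m : ℕ} (h : HasDesign v m) : HasDesign v v := by
  obtain ⟨Blocks, hP, -⟩ := h
  refine ⟨Blocks, hP, fun S _ => ⟨Finset.univ, ⟨subset_rfl, fun x _ y _ hxy => ?_⟩,
    Finset.subset_univ _, by simp⟩⟩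
  obtain ⟨B, ⟨hB, hx, hy⟩, -⟩ := hP.2 x (Finset.mem_univ _) y (Finset.mem_univ _) hxy
  exact ⟨B, hB, hx, hy, Finset.subset_univ _⟩

theorem HasDesign.mono {v m m' : ℕ} (h : HasDesign v m) (hm : m ≤ m') : HasDesign v m' := by
  obtain ⟨Blocks, hP, hF⟩ := h
  refine ⟨Blocks, hP, fun S hS => ?_⟩
  obtain ⟨Y, h1, h2, h3⟩ := hF S hS
  exact ⟨Y, h1, h2, h3.trans hm⟩

/-! ### Group divisible designs with groups of sizes three and one -/

/-- The index of the group of a point, in a set partitioned into `b` triples and `a` singletons. -/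
def groupOf {b a : ℕ} : (Fin b × Fin 3) ⊕ Fin a → Fin b ⊕ Fin a := Sum.map Prod.fst id

/-- A group divisible design with blocks of sizes `3`, `4`, `5`, with `b` groups of size three
and `a` groups of size one. -/
def HasTable (b a : ℕ) : Prop :=
  ∃ 𝓑 : Finset (Finset ((Fin b × Fin 3) ⊕ Fin a)),
    (∀ B ∈ 𝓑, B.card ∈ ({3, 4, 5} : Set ℕ) ∧
      ∀ x ∈ B, ∀ y ∈ B, groupOf x = groupOf y → x = y) ∧
    ∀ x y, groupOf x ≠ groupOf y → ∃! B, B ∈ 𝓑 ∧ x ∈ B ∧ y ∈ B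

/-- The group index of a point, for points numbered by `0, …, 3 b + a - 1`. -/
def groupIndex (b i : ℕ) : ℕ := if i < b * 3 then i / 3 else i

/-- Boolean test that a list of bit masks describes a group divisible design with `b` groups
of size three and `a` groups of size one. -/
def checkTable (b a : ℕ) (l : List ℕ) : Bool :=
  (l.all fun m =>
    decide (((List.range (b * 3 + a)).filter m.testBit).length ∈ [3, 4, 5])) &&
  (List.range (b * 3 + a)).all fun i => (List.range (b * 3 + a)).all fun j => i == j ||
    (l.filter fun m => m.testBit i && m.testBit j).length ==
      if groupIndex b i == groupIndex b j then 0 else 1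

theorem HasTable.of_check {b a : ℕ} (l : List ℕ) (h : checkTable b a l = true) :
    HasTable b a := by
  classical
  let e : (Fin b × Fin 3) ⊕ Fin a ≃ Fin (b * 3 + a) :=
    (Equiv.sumCongr finProdFinEquiv (Equiv.refl _)).trans finSumFinEquiv
  have hgroup : ∀ x y, groupOf x = groupOf y ↔ groupIndex b (e x) = groupIndex b (e y) := by
    have h1 : ∀ i j, (e (Sum.inl (i, j)) : ℕ) = j + 3 * i := fun i j => by
      simp [e]
    have h2 : ∀ k, (e (Sum.inr k) : ℕ) = b * 3 + k := fun k => by simp [e]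
    rintro (⟨i, j⟩ | k) (⟨i', j'⟩ | k')
    · simp only [h1, groupOf, groupIndex, Sum.map_inl, Sum.inl.injEq, Fin.ext_iff]
      have := i.2; have := j.2; have := i'.2; have := j'.2
      rw [if_pos (by omega), if_pos (by omega)]
      omega
    · simp only [h1, h2, groupOf, groupIndex, Sum.map_inl, Sum.map_inr, reduceCtorEq, false_iff]
      have := i.2; have := j.2
      rw [if_pos (by omega), if_neg (by omega)]
      omega
    · simp only [h1, h2, groupOf, groupIndex, Sum.map_inl, Sum.map_inr, reduceCtorEq, false_iff]
      have := i'.2; have := j'.2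
      rw [if_neg (by omega), if_pos (by omega)]
      omega
    · simp only [h2, groupOf, groupIndex, Sum.map_inr, Sum.inr.injEq, id, Fin.ext_iff]
      rw [if_neg (by omega), if_neg (by omega)]
      omega
  simp only [checkTable, Bool.and_eq_true, List.all_eq_true, List.mem_range, Bool.or_eq_true,
    beq_iff_eq, decide_eq_true_eq] at h
  obtain ⟨hsize, hpair⟩ := h
  let blk : ℕ → Finset ((Fin b × Fin 3) ⊕ Fin a) := fun m =>
    Finset.univ.filter fun x => m.testBit (e x) = true
  have hmem : ∀ m x, x ∈ blk m ↔ m.testBit (e x) = true := by simp [blk]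
  have hcard : ∀ m, (blk m).card = ((List.range (b * 3 + a)).filter m.testBit).length := by
    intro m
    have : ((List.range (b * 3 + a)).filter m.testBit).length
        = ((Finset.range (b * 3 + a)).filter fun i => m.testBit i = true).card := by
      simp [Finset.card, Finset.filter, Finset.range, Multiset.range]
    rw [this]
    refine Finset.card_bij (fun x _ => (e x : ℕ)) ?_ ?_ ?_
    · intro x hx
      exact Finset.mem_filter.2 ⟨Finset.mem_range.2 (e x).2, (hmem m x).1 hx⟩
    · intro x _ y _ hxy
      exact e.injective (Fin.ext hxy)
    · intro i hi
      obtain ⟨hi1, hi2⟩ := Finset.mem_filter.1 hi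
      exact ⟨e.symm ⟨i, Finset.mem_range.1 hi1⟩, by simpa [hmem] using hi2, by simp⟩
  refine ⟨(l.map blk).toFinset, ?_, ?_⟩
  · intro B hB
    simp only [List.mem_toFinset, List.mem_map] at hB
    obtain ⟨m, hm, rfl⟩ := hB
    refine ⟨by simpa [hcard] using hsize m hm, ?_⟩
    intro x hx y hy hxy
    by_contra hne
    have h0 := (hpair (e x) (e x).2 (e y) (e y).2).resolve_left
      (fun h' => hne (e.injective (Fin.ext h')))
    rw [if_pos ((hgroup x y).1 hxy), List.length_eq_zero_iff, List.filter_eq_nil_iff] at h0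
    exact h0 m hm (by simp [(hmem m x).1 hx, (hmem m y).1 hy])
  · intro x y hxy
    have h1 := (hpair (e x) (e x).2 (e y) (e y).2).resolve_left
      (fun h' => hxy (by rw [e.injective (Fin.ext h')]))
    rw [if_neg (fun h' => hxy ((hgroup x y).2 h')), List.length_eq_one_iff] at h1
    obtain ⟨m, hm⟩ := h1
    have hm' : ∀ k, k = m ↔ k ∈ l ∧ (k.testBit (e x) && k.testBit (e y)) = true := by
      intro k
      rw [← List.mem_singleton, ← hm, List.mem_filter]
    have hmm := (hm' m).1 rfl
    simp only [Bool.and_eq_true] at hmm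
    refine ⟨blk m, ⟨?_, (hmem _ _).2 hmm.2.1, (hmem _ _).2 hmm.2.2⟩, ?_⟩
    · simp only [List.mem_toFinset, List.mem_map]
      exact ⟨m, hmm.1, rfl⟩
    · rintro B ⟨hB, hxB, hyB⟩
      simp only [List.mem_toFinset, List.mem_map] at hB
      obtain ⟨k, hk, rfl⟩ := hB
      rw [(hm' k).2 ⟨hk, by simp [(hmem _ _).1 hxB, (hmem _ _).1 hyB]⟩]

/-! ### Wilson's fundamental construction -/

section Wilson

variable {P : Type*} [Fintype P] [DecidableEq P]

/-- The points obtained by replacing each `p` by `w p` copies of itself. -/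
def weightedPoints (w : P → ℕ) (Y : Finset P) : Finset (P × Fin 3) :=
  Finset.univ.filter fun x => x.1 ∈ Y ∧ (x.2 : ℕ) < w x.1

theorem mem_weightedPoints {w : P → ℕ} {Y : Finset P} {x : P × Fin 3} :
    x ∈ weightedPoints w Y ↔ x.1 ∈ Y ∧ (x.2 : ℕ) < w x.1 := by
  simp [weightedPoints]

theorem card_weightedPoints {w : P → ℕ} (hw : ∀ p, w p ≤ 3) (Y : Finset P) :
    (weightedPoints w Y).card = ∑ p ∈ Y, w p := by
  rw [Finset.card_eq_sum_card_fiberwise (f := Prod.fst) (t := Y)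
    (fun x hx => (mem_weightedPoints.1 hx).1)]
  refine Finset.sum_congr rfl fun p hp => ?_
  have : (weightedPoints w Y).filter (fun x => x.1 = p)
      = (Finset.univ.filter fun j : Fin 3 => (j : ℕ) < w p).map
        ⟨fun j => (p, j), fun i j h => by simpa using h⟩ := by
    ext ⟨q, j⟩
    simp only [Finset.mem_filter, mem_weightedPoints, Finset.mem_map, Finset.mem_univ, true_and]
    constructor
    · rintro ⟨⟨_, h⟩, rfl⟩; exact ⟨j, h, rfl⟩
    · rintro ⟨i, h, h'⟩
      obtain ⟨rfl, rfl⟩ := Prod.mk.inj h'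
      exact ⟨⟨hp, h⟩, rfl⟩
  rw [this, Finset.card_map]
  have h3 := hw p
  generalize w p = k at h3
  interval_cases k <;> decide

theorem HasTable.exists_blocks {w : P → ℕ} (hw : ∀ p, w p = 0 ∨ w p = 1 ∨ w p = 3)
    {L : Finset P}
    (h : HasTable (L.filter fun p => w p = 3).card (L.filter fun p => w p = 1).card) :
    ∃ 𝓑 : Finset (Finset (P × Fin 3)),
      (∀ B ∈ 𝓑, B ⊆ weightedPoints w L ∧ B.card ∈ ({3, 4, 5} : Set ℕ) ∧
        ∀ x ∈ B, ∀ y ∈ B, x.1 = y.1 → x = y) ∧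
      ∀ x ∈ weightedPoints w L, ∀ y ∈ weightedPoints w L, x.1 ≠ y.1 →
        ∃! B, B ∈ 𝓑 ∧ x ∈ B ∧ y ∈ B := by
  set b := (L.filter fun p => w p = 3).card
  set a := (L.filter fun p => w p = 1).card
  obtain ⟨𝓑, h1, h2⟩ := h
  let e3 : Fin b ≃ L.filter fun p => w p = 3 := (Finset.equivFin _).symm
  let e1 : Fin a ≃ L.filter fun p => w p = 1 := (Finset.equivFin _).symm
  have he3 : ∀ i, (e3 i : P) ∈ L ∧ w (e3 i) = 3 := fun i => Finset.mem_filter.1 (e3 i).2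
  have he1 : ∀ i, (e1 i : P) ∈ L ∧ w (e1 i) = 1 := fun i => Finset.mem_filter.1 (e1 i).2
  let f : (Fin b × Fin 3) ⊕ Fin a → P × Fin 3 :=
    Sum.elim (fun x => (e3 x.1, x.2)) (fun k => (e1 k, 0))
  have hgroup : ∀ x y, (f x).1 = (f y).1 ↔ groupOf x = groupOf y := by
    rintro (⟨i, j⟩ | k) (⟨i', j'⟩ | k')
    · simp [f, groupOf]
    · simp only [f, groupOf, Sum.elim_inl, Sum.elim_inr, Sum.map_inl, Sum.map_inr, reduceCtorEq,
        iff_false]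
      intro h
      have := (he3 i).2; rw [h, (he1 k').2] at this; omega
    · simp only [f, groupOf, Sum.elim_inl, Sum.elim_inr, Sum.map_inl, Sum.map_inr, reduceCtorEq,
        iff_false]
      intro h
      have := (he3 i').2; rw [← h, (he1 k).2] at this; omega
    · simp [f, groupOf]
  have hinj : Function.Injective f := by
    intro x y hxy
    have := (hgroup x y).1 (congrArg Prod.fst hxy)
    have h' := congrArg Prod.snd hxy
    rcases x with ⟨i, j⟩ | k <;> rcases y with ⟨i', j'⟩ | k' <;>
      simp [groupOf, f] at this h' ⊢ <;> simp_all
  have hrange : ∀ x, x ∈ weightedPoints w L ↔ ∃ z, f z = x := by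
    rintro ⟨p, j⟩
    rw [mem_weightedPoints]
    constructor
    · rintro ⟨hp, hj⟩
      rcases hw p with h0 | h0 | h0
      · simp only [h0] at hj; omega
      · refine ⟨Sum.inr (e1.symm ⟨p, Finset.mem_filter.2 ⟨hp, h0⟩⟩), ?_⟩
        have : j = 0 := by simp only [h0] at hj; omega
        simp [f, this]
      · exact ⟨Sum.inl (e3.symm ⟨p, Finset.mem_filter.2 ⟨hp, h0⟩⟩, j), by simp [f]⟩
    · rintro ⟨⟨i, k⟩ | k, hz⟩
      · simp only [f, Sum.elim_inl, Prod.mk.injEq] at hz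
        obtain ⟨rfl, rfl⟩ := hz
        exact ⟨(he3 i).1, by rw [(he3 i).2]; exact k.2⟩
      · simp only [f, Sum.elim_inr, Prod.mk.injEq] at hz
        obtain ⟨rfl, rfl⟩ := hz
        exact ⟨(he1 k).1, by rw [(he1 k).2]; exact Nat.one_pos⟩
  refine ⟨𝓑.image fun B => B.map ⟨f, hinj⟩, ?_, ?_⟩
  · intro B hB
    obtain ⟨C, hC, rfl⟩ := Finset.mem_image.1 hB
    refine ⟨fun x hx => ?_, by rw [Finset.card_map]; exact (h1 C hC).1, ?_⟩
    · obtain ⟨z, _, rfl⟩ := Finset.mem_map.1 hx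
      exact (hrange _).2 ⟨z, rfl⟩
    · intro x hx y hy hxy
      obtain ⟨z, hz, rfl⟩ := Finset.mem_map.1 hx
      obtain ⟨z', hz', rfl⟩ := Finset.mem_map.1 hy
      rw [(h1 C hC).2 z hz z' hz' ((hgroup _ _).1 hxy)]
  · intro x hx y hy hxy
    obtain ⟨z, rfl⟩ := (hrange x).1 hx
    obtain ⟨z', rfl⟩ := (hrange y).1 hy
    have hm : ∀ (C : Finset _) u, f u ∈ C.map ⟨f, hinj⟩ ↔ u ∈ C := fun C u =>
      Finset.mem_map' (⟨f, hinj⟩ : _ ↪ P × Fin 3)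
    obtain ⟨C, ⟨hC, hzC, hzC'⟩, huniq⟩ := h2 z z' (fun h => hxy ((hgroup _ _).2 h))
    refine ⟨C.map ⟨f, hinj⟩, ⟨Finset.mem_image_of_mem _ hC, (hm _ _).2 hzC, (hm _ _).2 hzC'⟩, ?_⟩
    rintro B ⟨hB, hxB, hyB⟩
    obtain ⟨C', hC', rfl⟩ := Finset.mem_image.1 hB
    rw [huniq C' ⟨hC', (hm _ _).1 hxB, (hm _ _).1 hyB⟩]

/-- Replace the points of a linear space by groups of sizes `0`, `1`, `3` and fill the lines with
group divisible designs. -/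
theorem HasDesign.of_weights (w : P → ℕ) (hw : ∀ p, w p = 0 ∨ w p = 1 ∨ w p = 3)
    (𝓛 : Finset (Finset P)) (hlin : ∀ p q, p ≠ q → ∃! L, L ∈ 𝓛 ∧ p ∈ L ∧ q ∈ L)
    (htable : ∀ L ∈ 𝓛,
      HasTable (L.filter fun p => w p = 3).card (L.filter fun p => w p = 1).card)
    {m : ℕ}
    (hclosed : ∀ p q r, ∃ Y : Finset P, p ∈ Y ∧ q ∈ Y ∧ r ∈ Y ∧
      (∀ L ∈ 𝓛, ∀ x ∈ L, ∀ y ∈ L, x ≠ y → x ∈ Y → y ∈ Y → L ⊆ Y) ∧ ∑ x ∈ Y, w x ≤ m) :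
    HasDesign (∑ p, w p) m := by
  have hw3 : ∀ p, w p ≤ 3 := fun p => by rcases hw p with h | h | h <;> omega
  rw [← card_weightedPoints hw3]
  choose! 𝓑 hB hpair using fun L hL => HasTable.exists_blocks hw (htable L hL)
  let fib : P → Finset (P × Fin 3) := fun p => weightedPoints w {p}
  have hfib : ∀ p x, x ∈ fib p ↔ x.1 = p ∧ (x.2 : ℕ) < w x.1 := by
    intro p x; simp [fib, mem_weightedPoints]
  let Blocks : Finset (Finset (P × Fin 3)) :=
    𝓛.biUnion 𝓑 ∪ (Finset.univ.filter fun p => w p = 3).image fib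
  have hBlocks : ∀ B, B ∈ Blocks ↔ (∃ L ∈ 𝓛, B ∈ 𝓑 L) ∨ ∃ p, w p = 3 ∧ fib p = B := by
    intro B; simp [Blocks]
  have hsame : ∀ x y : P × Fin 3, x ≠ y → x.1 = y.1 → (x.2 : ℕ) < w x.1 →
      (y.2 : ℕ) < w y.1 → w x.1 = 3 := by
    rintro ⟨p, i⟩ ⟨q, j⟩ hxy rfl hi hj
    rcases hw p with h | h | h
    · simp only [h] at hi; omega
    · simp only [h] at hi hj
      obtain rfl : i = j := by omega
      exact absurd rfl hxy
    · exact h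
  have hlift : ∀ (L Y : Finset P) (x : P × Fin 3), L ⊆ Y → x ∈ weightedPoints w L →
      x ∈ weightedPoints w Y := fun L Y x hLY hx =>
    mem_weightedPoints.2 ⟨hLY (mem_weightedPoints.1 hx).1, (mem_weightedPoints.1 hx).2⟩
  refine HasDesign.of_isPBD (Blocks := Blocks) ⟨?_, ?_⟩ ?_
  · intro B hBB
    rcases (hBlocks B).1 hBB with ⟨L, hL, hBL⟩ | ⟨p, hp, rfl⟩
    · obtain ⟨h1, h2, -⟩ := hB L hL B hBL
      exact ⟨fun x hx => hlift _ _ x (Finset.subset_univ _) (h1 hx), h2⟩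
    · refine ⟨fun x hx => hlift _ _ x (Finset.subset_univ _) hx, ?_⟩
      rw [card_weightedPoints hw3, Finset.sum_singleton, hp]
      simp
  · intro x hx y hy hxy
    have hx' := (mem_weightedPoints.1 hx).2
    have hy' := (mem_weightedPoints.1 hy).2
    by_cases hp : x.1 = y.1
    · refine ⟨fib x.1, ⟨(hBlocks _).2 (Or.inr ⟨_, hsame x y hxy hp hx' hy', rfl⟩),
        (hfib _ _).2 ⟨rfl, hx'⟩, (hfib _ _).2 ⟨hp.symm, hy'⟩⟩, ?_⟩
      rintro B ⟨hBB, hxB, hyB⟩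
      rcases (hBlocks B).1 hBB with ⟨L, hL, hBL⟩ | ⟨p, -, rfl⟩
      · exact absurd ((hB L hL B hBL).2.2 x hxB y hyB hp) hxy
      · rw [((hfib _ _).1 hxB).1]
    · obtain ⟨L, ⟨hL, hxL, hyL⟩, hLu⟩ := hlin _ _ hp
      obtain ⟨B, ⟨hBL, hxB, hyB⟩, hBu⟩ := hpair L hL x (mem_weightedPoints.2 ⟨hxL, hx'⟩) y
        (mem_weightedPoints.2 ⟨hyL, hy'⟩) hp
      refine ⟨B, ⟨(hBlocks _).2 (Or.inl ⟨L, hL, hBL⟩), hxB, hyB⟩, ?_⟩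
      rintro C ⟨hC, hxC, hyC⟩
      rcases (hBlocks C).1 hC with ⟨L', hL', hCL⟩ | ⟨p, -, rfl⟩
      · have h1 := (hB L' hL' C hCL).1
        obtain rfl := hLu L' ⟨hL', (mem_weightedPoints.1 (h1 hxC)).1,
          (mem_weightedPoints.1 (h1 hyC)).1⟩
        exact hBu C ⟨hCL, hxC, hyC⟩
      · exact absurd (((hfib _ _).1 hxC).1.trans ((hfib _ _).1 hyC).1.symm) hp
  · intro S hS hS3
    obtain ⟨x, y, z, -, -, -, rfl⟩ := Finset.card_eq_three.1 hS3
    obtain ⟨Y, hxY, hyY, hzY, hYc, hYm⟩ := hclosed x.1 y.1 z.1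
    refine ⟨weightedPoints w Y,
      ⟨fun u hu => hlift _ _ u (Finset.subset_univ _) hu, ?_⟩, ?_,
      by rwa [card_weightedPoints hw3]⟩
    · intro u hu v hv huv
      obtain ⟨huY, hu'⟩ := mem_weightedPoints.1 hu
      obtain ⟨hvY, hv'⟩ := mem_weightedPoints.1 hv
      by_cases hp : u.1 = v.1
      · exact ⟨fib u.1, (hBlocks _).2 (Or.inr ⟨_, hsame u v huv hp hu' hv', rfl⟩),
          (hfib _ _).2 ⟨rfl, hu'⟩, (hfib _ _).2 ⟨hp.symm, hv'⟩,
          fun t ht => hlift _ _ t (Finset.singleton_subset_iff.2 huY) ht⟩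
      · obtain ⟨L, ⟨hL, huL, hvL⟩, -⟩ := hlin _ _ hp
        obtain ⟨B, ⟨hBL, huB, hvB⟩, -⟩ := hpair L hL u (mem_weightedPoints.2 ⟨huL, hu'⟩) v
          (mem_weightedPoints.2 ⟨hvL, hv'⟩) hp
        exact ⟨B, (hBlocks _).2 (Or.inl ⟨L, hL, hBL⟩), huB, hvB, fun t ht =>
          hlift _ _ t (hYc L hL _ huL _ hvL hp huY hvY) ((hB L hL B hBL).1 ht)⟩
    · have hV : ∀ u ∈ ({x, y, z} : Finset (P × Fin 3)), (u.2 : ℕ) < w u.1 := fun u hu =>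
        (mem_weightedPoints.1 (hS hu)).2
      intro u hu
      refine mem_weightedPoints.2 ⟨?_, hV u hu⟩
      simp only [Finset.mem_insert, Finset.mem_singleton] at hu
      rcases hu with rfl | rfl | rfl <;> assumption

end Wilson

/-! ### Small group divisible designs -/

theorem hasTable_0_0 : HasTable 0 0 :=
  .of_check
    []
    (by decide +kernel)

theorem hasTable_0_1 : HasTable 0 1 :=
  .of_check
    []
    (by decide +kernel)

theorem hasTable_0_3 : HasTable 0 3 :=
  .of_check
    [7]
    (by decide +kernel)

theorem hasTable_0_4 : HasTable 0 4 :=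
  .of_check
    [15]
    (by decide +kernel)

theorem hasTable_0_5 : HasTable 0 5 :=
  .of_check
    [31]
    (by decide +kernel)

theorem hasTable_1_4 : HasTable 1 4 :=
  .of_check
    [25, 42, 52, 76, 82, 97]
    (by decide +kernel)

theorem hasTable_1_19 : HasTable 1 19 :=
  .of_check
    [26, 44, 49, 73, 84, 98, 1408, 2816, 5632, 6272, 8832, 11264, 12544, 16704, 16928, 17424,
    18436, 20488, 24578, 32898, 33025, 33344, 33824, 36868, 40968, 65672, 66049, 66624, 67616,
    69648, 73732, 131204, 131336, 131586, 132097, 133184, 139280, 180224, 262288, 262404,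
    263170, 264193, 266304, 270368, 360448, 524448, 524560, 524804, 525320, 526338, 528385,
    720896, 802816, 1048768, 1048864, 1049104, 1050632, 1052674, 1056769, 1130496, 1441792,
    1605632, 2113665, 2131984, 2162946, 2232352, 2359816, 2629696, 3146756]
    (by decide +kernel)

theorem hasTable_2_3 : HasTable 2 3 :=
  .of_check
    [76, 82, 97, 137, 148, 162, 266, 273, 292, 448]
    (by decide +kernel)

theorem hasTable_2_18 : HasTable 2 18 :=
  .of_check
    [194, 324, 385, 577, 644, 770, 3088, 5152, 6152, 9224, 10272, 12304, 16912, 17664, 18436,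
    20544, 32785, 34304, 36868, 41024, 66080, 66561, 69760, 73732, 131084, 131105, 132098,
    139392, 180224, 262178, 262280, 264193, 270592, 360448, 524384, 524432, 524552, 526338,
    720896, 802816, 1048848, 1049096, 1050688, 1052674, 1130496, 1441792, 1605632, 2113545,
    2132096, 2162706, 2232576, 2360384, 2630144, 3145764, 4210848, 4227082, 4262144, 4325456,
    4461056, 4719620, 5251073, 8413186, 8421664, 8454216, 8522240, 8650772, 8916993, 9438336,
    14680064]
    (by decide +kernel)

theorem hasTable_3_1 : HasTable 3 1 :=
  .of_check
    [84, 97, 137, 146, 268, 290, 586, 676, 785]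
    (by decide +kernel)

theorem hasTable_3_2 : HasTable 3 2 :=
  .of_check
    [76, 98, 138, 145, 276, 289, 521, 592, 770, 1042, 1089, 1288, 1700]
    (by decide +kernel)

theorem hasTable_4_0 : HasTable 4 0 :=
  .of_check
    [594, 652, 801, 1097, 1186, 1300, 2148, 2193, 2314]
    (by decide +kernel)

theorem hasTable_4_1 : HasTable 4 1 :=
  .of_check
    [82, 97, 162, 268, 522, 548, 656, 769, 1044, 1096, 1153, 1312, 2065, 2116, 2184, 2306, 4105,
    4228, 4368, 4672, 5122, 6176]
    (by decide +kernel)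

theorem hasTable_5_0 : HasTable 5 0 :=
  .of_check
    [76, 98, 145, 522, 672, 772, 1042, 1156, 1281, 2081, 2128, 2312, 4105, 4116, 4354, 4672,
    5152, 6272, 8228, 8328, 8464, 8705, 9280, 10242, 16449, 16514, 16672, 16912, 17416, 18436]
    (by decide +kernel)

theorem hasTable_5_15 : HasTable 5 15 :=
  .of_check
    [6160, 8321, 16641, 32777, 32788, 32802, 37376, 65548, 65554, 65569, 69888, 74240, 82944,
    131082, 131089, 131108, 135296, 139520, 147968, 229376, 262720, 263424, 264320, 266248,
    270352, 278560, 525056, 525440, 526400, 528388, 532488, 540688, 1049216, 1049664, 1050880,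
    1056772, 1064968, 1835008, 2097224, 2097410, 2097665, 2229248, 2621472, 3145744, 4194384,
    4194818, 4195329, 4327424, 4751360, 5242912, 8388704, 8388752, 8389124, 8389634, 8390657,
    9469952, 14680064, 16777376, 16778244, 16779266, 16810048, 17039361, 17891328, 18878464,
    20987904, 25174016, 33554720, 33555464, 33556484, 33587328, 33620032, 33816578, 35667968,
    37756928, 41947136, 67110920, 67141888, 67174528, 67240000, 67371012, 67633154, 69214208,
    71307264, 75513856, 117440512, 134221889, 134228000, 134234242, 136609792, 138412292,
    143196160, 150995464, 168951808, 201327632, 268440608, 268443714, 268486656, 270532740,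
    272957440, 276824328, 285868032, 301990416, 336592897, 536887364, 536912896, 537923586,
    539035648, 541065352, 545652736, 553648400, 570949633, 603980320, 939524096]
    (by decide +kernel)

/-! ### The field with four elements -/

/-- The field with four elements, on the carrier `Fin 4`. -/
def F4 : Type := Fin 4

namespace F4

instance : DecidableEq F4 := inferInstanceAs (DecidableEq (Fin 4))
instance : Fintype F4 := inferInstanceAs (Fintype (Fin 4))
instance : Zero F4 := ⟨(0 : Fin 4)⟩
instance : One F4 := ⟨(1 : Fin 4)⟩
instance : Add F4 := ⟨fun x y =>
  (![![0, 1, 2, 3], ![1, 0, 3, 2], ![2, 3, 0, 1], ![3, 2, 1, 0]] : Fin 4 → Fin 4 → Fin 4) x y⟩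
instance : Mul F4 := ⟨fun x y =>
  (![![0, 0, 0, 0], ![0, 1, 2, 3], ![0, 2, 3, 1], ![0, 3, 1, 2]] : Fin 4 → Fin 4 → Fin 4) x y⟩
instance : Neg F4 := ⟨fun x => x⟩
instance : Inv F4 := ⟨(![0, 1, 3, 2] : Fin 4 → Fin 4)⟩

instance : Field F4 where
  add_assoc := by decide
  zero_add := by decide
  add_zero := by decide
  add_comm := by decide
  neg_add_cancel := by decide
  mul_assoc := by decide
  one_mul := by decide
  mul_one := by decide
  left_distrib := by decide
  right_distrib := by decide
  zero_mul := by decide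
  mul_zero := by decide
  mul_comm := by decide
  exists_pair_ne := ⟨0, 1, by decide⟩
  mul_inv_cancel := by decide
  inv_zero := by decide
  nsmul := nsmulRec
  zsmul := zsmulRec
  nnqsmul := _
  qsmul := _

theorem card_eq : Fintype.card F4 = 4 := rfl
end F4

/-! ### Subspaces of projective spaces of order four -/

section Projective

open Projectivization Module
open scoped LinearAlgebra.Projectivization Classical

variable {V : Type*} [AddCommGroup V] [Module F4 V]

theorem finrank_sup_of_ne {p q : ℙ F4 V} (h : p ≠ q) :
    finrank F4 (p.submodule ⊔ q.submodule : Submodule F4 V) = 2 := by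
  have h1 := Submodule.finrank_sup_add_finrank_inf_eq p.submodule q.submodule
  rw [finrank_submodule, finrank_submodule] at h1
  have h2 : finrank F4 (p.submodule ⊓ q.submodule : Submodule F4 V) = 0 := by
    by_contra h0
    have hle : 1 ≤ finrank F4 (p.submodule ⊓ q.submodule : Submodule F4 V) :=
      Nat.one_le_iff_ne_zero.2 h0
    have hp := Submodule.eq_of_le_of_finrank_le (inf_le_left : p.submodule ⊓ q.submodule ≤ _)
      (by rwa [finrank_submodule])
    have hq := Submodule.eq_of_le_of_finrank_le (inf_le_right : p.submodule ⊓ q.submodule ≤ _)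
      (by rwa [finrank_submodule])
    exact h (submodule_injective (hp.symm.trans hq))
  omega

theorem finrank_sup_three_le (p q r : ℙ F4 V) :
    finrank F4 (p.submodule ⊔ q.submodule ⊔ r.submodule : Submodule F4 V) ≤ 3 := by
  have h1 := Submodule.finrank_add_le_finrank_add_finrank (p.submodule ⊔ q.submodule) r.submodule
  have h2 := Submodule.finrank_add_le_finrank_add_finrank p.submodule q.submodule
  rw [finrank_submodule] at h1
  rw [finrank_submodule, finrank_submodule] at h2
  omega

variable [Fintype V]

noncomputable instance Projectivization.fintypeOfF4 : Fintype (ℙ F4 V) := Fintype.ofFinite _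

/-- The nonzero vectors spanning the points in a set of points. -/
noncomputable def coneOver (C : Finset (ℙ F4 V)) : Finset V :=
  Finset.univ.filter fun x => ∃ h : x ≠ 0, mk F4 x h ∈ C

theorem mem_coneOver {C : Finset (ℙ F4 V)} {x : V} :
    x ∈ coneOver C ↔ ∃ h : x ≠ 0, mk F4 x h ∈ C := by
  simp [coneOver]

theorem smul_mem_coneOver {C : Finset (ℙ F4 V)} {c : F4} (hc : c ≠ 0) {x : V}
    (hx : x ∈ coneOver C) : c • x ∈ coneOver C := by
  obtain ⟨h, hx⟩ := mem_coneOver.1 hx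
  refine mem_coneOver.2 ⟨smul_ne_zero hc h, ?_⟩
  rwa [(mk_eq_mk_iff' F4 (c • x) x (smul_ne_zero hc h) h).2 ⟨c, rfl⟩]

theorem card_coneOver (C : Finset (ℙ F4 V)) : (coneOver C).card = 3 * C.card := by
  have h3 : (Finset.univ.erase (0 : F4)).card = 3 := rfl
  rw [← h3, ← Finset.card_product]
  symm
  refine Finset.card_bij (fun a _ => a.1 • a.2.rep) ?_ ?_ ?_
  · rintro ⟨t, p⟩ h
    obtain ⟨ht, hp⟩ := Finset.mem_product.1 h
    have ht' : t ≠ 0 := (Finset.mem_erase.1 ht).1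
    refine smul_mem_coneOver ht' (mem_coneOver.2 ⟨p.rep_nonzero, ?_⟩)
    rwa [mk_rep]
  · rintro ⟨t, p⟩ h ⟨s, q⟩ h' heq
    have ht : t ≠ 0 := (Finset.mem_erase.1 (Finset.mem_product.1 h).1).1
    dsimp only at heq
    have hpq : p = q := by
      rw [← mk_rep p, ← mk_rep q, mk_eq_mk_iff']
      exact ⟨t⁻¹ * s, by rw [mul_smul, ← heq, smul_smul, inv_mul_cancel₀ ht, one_smul]⟩
    subst hpq
    have : (t - s) • p.rep = 0 := by rw [sub_smul, heq, sub_self]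
    rcases smul_eq_zero.1 this with h0 | h0
    · rw [sub_eq_zero.1 h0]
    · exact absurd h0 p.rep_nonzero
  · intro x hx
    obtain ⟨h, hx⟩ := mem_coneOver.1 hx
    obtain ⟨a, ha⟩ := exists_smul_eq_mk_rep F4 x h
    refine ⟨((a⁻¹ : F4ˣ), mk F4 x h), Finset.mem_product.2 ⟨?_, hx⟩, ?_⟩
    · exact Finset.mem_erase.2 ⟨(a⁻¹).ne_zero, Finset.mem_univ _⟩
    · dsimp only
      rw [← ha, Units.smul_def, smul_smul, Units.inv_mul, one_smul]

/-- The points spanned by vectors of a scalar invariant set. -/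
noncomputable def pointsOf (S : V → Prop) : Finset (ℙ F4 V) :=
  Finset.univ.filter fun p => S p.rep

theorem mem_pointsOf {S : V → Prop} {p : ℙ F4 V} : p ∈ pointsOf S ↔ S p.rep := by
  simp [pointsOf]

theorem mk_mem_pointsOf {S : V → Prop} (hS : ∀ c : F4, c ≠ 0 → ∀ x, S x → S (c • x))
    {x : V} (hx : x ≠ 0) : mk F4 x hx ∈ pointsOf S ↔ S x := by
  rw [mem_pointsOf]
  obtain ⟨a, ha⟩ := exists_smul_eq_mk_rep F4 x hx
  rw [← ha]
  constructor
  · intro h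
    have := hS _ (a⁻¹).ne_zero _ h
    rwa [Units.smul_def, smul_smul, Units.inv_mul, one_smul] at this
  · exact hS _ a.ne_zero _

theorem card_pointsOf {S : V → Prop} (hS : ∀ c : F4, c ≠ 0 → ∀ x, S x → S (c • x))
    (h0 : ¬ S 0) : 3 * (pointsOf S).card = (Finset.univ.filter S).card := by
  rw [← card_coneOver]
  congr 1
  ext x
  rw [mem_coneOver, Finset.mem_filter]
  constructor
  · rintro ⟨h, hx⟩; exact ⟨Finset.mem_univ _, (mk_mem_pointsOf hS h).1 hx⟩
  · rintro ⟨-, hx⟩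
    have h : x ≠ 0 := by rintro rfl; exact h0 hx
    exact ⟨h, (mk_mem_pointsOf hS h).2 hx⟩

/-- The points of the projectivization of a subspace. -/
noncomputable def pts (W : Submodule F4 V) : Finset (ℙ F4 V) :=
  Finset.univ.filter fun p => p.submodule ≤ W

theorem mem_pts {W : Submodule F4 V} {p : ℙ F4 V} : p ∈ pts W ↔ p.submodule ≤ W := by
  simp [pts]

theorem mk_mem_pts {W : Submodule F4 V} {x : V} (hx : x ≠ 0) : mk F4 x hx ∈ pts W ↔ x ∈ W := by
  rw [mem_pts, submodule_mk, Submodule.span_singleton_le_iff_mem]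

theorem rep_mem_iff {W : Submodule F4 V} {p : ℙ F4 V} : p.rep ∈ W ↔ p ∈ pts W := by
  rw [mem_pts, submodule_eq, Submodule.span_singleton_le_iff_mem]

theorem card_pts (W : Submodule F4 V) : 3 * (pts W).card + 1 = 4 ^ finrank F4 W := by
  have h1 : coneOver (pts W) = (Finset.univ.filter fun x => x ∈ W).erase 0 := by
    ext x
    rw [mem_coneOver, Finset.mem_erase, Finset.mem_filter]
    constructor
    · rintro ⟨h, hx⟩; exact ⟨h, Finset.mem_univ _, (mk_mem_pts h).1 hx⟩
    · rintro ⟨h, -, hx⟩; exact ⟨h, (mk_mem_pts h).2 hx⟩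
  rw [← card_coneOver, h1, Finset.card_erase_add_one (by simp), ← Fintype.card_subtype,
    ← F4.card_eq]
  exact Module.card_eq_pow_finrank (K := F4) (V := W)

theorem card_univ_points : 3 * (Finset.univ : Finset (ℙ F4 V)).card + 1 = 4 ^ finrank F4 V := by
  have := card_pts (⊤ : Submodule F4 V)
  rwa [finrank_top, show pts (⊤ : Submodule F4 V) = Finset.univ by ext; simp [mem_pts]] at this

theorem card_pts_of_finrank_two {W : Submodule F4 V} (hW : finrank F4 W = 2) :
    (pts W).card = 5 := by
  have := card_pts W
  rw [hW] at this
  omega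

theorem card_pts_of_finrank_three {W : Submodule F4 V} (hW : finrank F4 W = 3) :
    (pts W).card = 21 := by
  have := card_pts W
  rw [hW] at this
  omega

theorem card_pts_le {W : Submodule F4 V} {k : ℕ} (hW : finrank F4 W ≤ k) :
    3 * (pts W).card + 1 ≤ 4 ^ k :=
  (card_pts W).trans_le (Nat.pow_le_pow_right (by norm_num) hW)

theorem eq_sup_of_mem_pts {W : Submodule F4 V} (hW : finrank F4 W = 2) {p q : ℙ F4 V}
    (h : p ≠ q) (hp : p ∈ pts W) (hq : q ∈ pts W) : p.submodule ⊔ q.submodule = W :=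
  Submodule.eq_of_le_of_finrank_le (sup_le (mem_pts.1 hp) (mem_pts.1 hq))
    (by rw [finrank_sup_of_ne h, hW])

theorem pts_mono {W W' : Submodule F4 V} (h : W ≤ W') : pts W ⊆ pts W' := fun _ hp =>
  mem_pts.2 ((mem_pts.1 hp).trans h)

/-- The lines of the projective space. -/
noncomputable def projLines (V : Type*) [AddCommGroup V] [Module F4 V] [Fintype V] :
    Finset (Finset (ℙ F4 V)) :=
  Finset.univ.filter fun L => ∃ W : Submodule F4 V, finrank F4 W = 2 ∧ pts W = L

theorem mem_projLines {L : Finset (ℙ F4 V)} :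
    L ∈ projLines V ↔ ∃ W : Submodule F4 V, finrank F4 W = 2 ∧ pts W = L := by
  simp [projLines]

theorem subset_pts_of_mem_projLines {L : Finset (ℙ F4 V)} (hL : L ∈ projLines V)
    {W : Submodule F4 V} {p q : ℙ F4 V} (hpq : p ≠ q) (hp : p ∈ L) (hq : q ∈ L)
    (hpW : p ∈ pts W) (hqW : q ∈ pts W) : L ⊆ pts W := by
  obtain ⟨U, hU, rfl⟩ := mem_projLines.1 hL
  rw [← eq_sup_of_mem_pts hU hpq hp hq]
  exact pts_mono (sup_le (mem_pts.1 hpW) (mem_pts.1 hqW))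

theorem existsUnique_projLine {p q : ℙ F4 V} (h : p ≠ q) :
    ∃! L, L ∈ projLines V ∧ p ∈ L ∧ q ∈ L := by
  refine ⟨pts (p.submodule ⊔ q.submodule), ⟨mem_projLines.2 ⟨_, finrank_sup_of_ne h, rfl⟩,
    mem_pts.2 le_sup_left, mem_pts.2 le_sup_right⟩, ?_⟩
  rintro L ⟨hL, hp, hq⟩
  obtain ⟨W, hW, rfl⟩ := mem_projLines.1 hL
  rw [eq_sup_of_mem_pts hW h hp hq]

/-- Weights on a projective space for which every line can be filled. -/
theorem HasDesign.of_projective (w : ℙ F4 V → ℕ) (hw : ∀ p, w p = 0 ∨ w p = 1 ∨ w p = 3)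
    (htable : ∀ W : Submodule F4 V, finrank F4 W = 2 →
      HasTable ((pts W).filter fun p => w p = 3).card ((pts W).filter fun p => w p = 1).card) :
    HasDesign (∑ p, w p) 63 := by
  refine HasDesign.of_weights w hw (projLines V) (fun p q h => existsUnique_projLine h) ?_ ?_
  · intro L hL
    obtain ⟨W, hW, rfl⟩ := mem_projLines.1 hL
    exact htable W hW
  · intro p q r
    refine ⟨pts (p.submodule ⊔ q.submodule ⊔ r.submodule),
      mem_pts.2 (le_sup_left.trans le_sup_left), mem_pts.2 (le_sup_right.trans le_sup_left),
      mem_pts.2 le_sup_right,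
      fun L hL x hx y hy hxy hx' hy' => subset_pts_of_mem_projLines hL hxy hx hy hx' hy', ?_⟩
    have h21 := card_pts_le (finrank_sup_three_le p q r)
    refine (Finset.sum_le_card_nsmul _ w 3
      (fun x _ => by rcases hw x with h | h | h <;> omega)).trans ?_
    rw [smul_eq_mul]
    omega

/-- Weights on a projective space in which a plane is filled as a whole. -/
theorem HasDesign.of_projective_plane (w : ℙ F4 V → ℕ)
    (hw : ∀ p, w p = 0 ∨ w p = 1 ∨ w p = 3)
    (N : Submodule F4 V) (hN : finrank F4 N = 3) (hwN : ∀ p ∉ pts N, w p = 1)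
    (hsum : ∑ p ∈ pts N, w p ≤ 30)
    (htable : HasTable ((pts N).filter fun p => w p = 3).card
      ((pts N).filter fun p => w p = 1).card) :
    HasDesign (∑ p, w p) 94 := by
  let 𝓛 := (projLines V).filter (fun L => ¬ L ⊆ pts N) ∪ {pts N}
  have h𝓛 : ∀ L, L ∈ 𝓛 ↔ (L ∈ projLines V ∧ ¬ L ⊆ pts N) ∨ L = pts N := by
    simp [𝓛, or_comm]
  refine HasDesign.of_weights w hw 𝓛 (fun p q h => ?_) ?_ ?_
  · by_cases hpq : p ∈ pts N ∧ q ∈ pts N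
    · refine ⟨pts N, ⟨(h𝓛 _).2 (Or.inr rfl), hpq⟩, ?_⟩
      rintro L ⟨hL, hp, hq⟩
      rcases (h𝓛 L).1 hL with ⟨hL1, hL2⟩ | rfl
      · exact absurd (subset_pts_of_mem_projLines hL1 h hp hq hpq.1 hpq.2) hL2
      · rfl
    · obtain ⟨L, ⟨hL, hp, hq⟩, hu⟩ := existsUnique_projLine h
      refine ⟨L, ⟨(h𝓛 _).2 (Or.inl ⟨hL, fun hs => hpq ⟨hs hp, hs hq⟩⟩), hp, hq⟩, ?_⟩
      rintro L' ⟨hL', hp', hq'⟩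
      rcases (h𝓛 L').1 hL' with ⟨hL1, -⟩ | rfl
      · exact hu L' ⟨hL1, hp', hq'⟩
      · exact absurd ⟨hp', hq'⟩ hpq
  · intro L hL
    rcases (h𝓛 L).1 hL with ⟨hL1, hL2⟩ | rfl
    · obtain ⟨W, hW, rfl⟩ := mem_projLines.1 hL1
      have hc : ((pts W).filter fun p => w p ≠ 1).card ≤ 1 := by
        refine Finset.card_le_one.2 fun p hp q hq => ?_
        by_contra hpq
        obtain ⟨hp, hp1⟩ := Finset.mem_filter.1 hp
        obtain ⟨hq, hq1⟩ := Finset.mem_filter.1 hq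
        exact hL2 (subset_pts_of_mem_projLines hL1 hpq hp hq
          (by_contra fun h => hp1 (hwN p h)) (by_contra fun h => hq1 (hwN q h)))
      have h3 : ((pts W).filter fun p => w p = 3).card ≤
          ((pts W).filter fun p => w p ≠ 1).card :=
        Finset.card_le_card (Finset.monotone_filter_right _ fun p _ (h : w p = 3) => by
          show w p ≠ 1; omega)
      have h5 := Finset.card_filter_add_card_filter_not (s := pts W) (fun p => w p = 1)
      rw [card_pts_of_finrank_two hW] at h5
      have h51 : ((pts W).filter fun p => ¬ w p = 1).card =
          ((pts W).filter fun p => w p ≠ 1).card := rfl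
      obtain h0 | ⟨h0, h1 | h1⟩ :
          (((pts W).filter fun p => w p = 1).card = 5 ∧
            ((pts W).filter fun p => w p = 3).card = 0) ∨
          ((pts W).filter fun p => w p = 1).card = 4 ∧
            (((pts W).filter fun p => w p = 3).card = 0 ∨
              ((pts W).filter fun p => w p = 3).card = 1) := by omega
      · rw [h0.1, h0.2]; exact hasTable_0_5
      · rw [h0, h1]; exact hasTable_0_4
      · rw [h0, h1]; exact hasTable_1_4
    · exact htable
  · intro p q r
    set W := p.submodule ⊔ q.submodule ⊔ r.submodule with hWdef
    have hp : p ∈ pts W := mem_pts.2 (le_sup_left.trans le_sup_left)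
    have hq : q ∈ pts W := mem_pts.2 (le_sup_right.trans le_sup_left)
    have hr : r ∈ pts W := mem_pts.2 le_sup_right
    have hW3 : finrank F4 W ≤ 3 := finrank_sup_three_le p q r
    by_cases hWN : finrank F4 (W ⊓ N : Submodule F4 V) ≤ 1
    · refine ⟨pts W, hp, hq, hr, ?_, ?_⟩
      · intro L hL x hx y hy hxy hxW hyW
        rcases (h𝓛 L).1 hL with ⟨hL1, -⟩ | rfl
        · exact subset_pts_of_mem_projLines hL1 hxy hx hy hxW hyW
        · exfalso
          have h1 : x.submodule ⊔ y.submodule ≤ W ⊓ N :=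
            sup_le (le_inf (mem_pts.1 hxW) (mem_pts.1 hx)) (le_inf (mem_pts.1 hyW) (mem_pts.1 hy))
          have h2 := Submodule.finrank_mono h1
          rw [finrank_sup_of_ne hxy] at h2
          omega
      · have h21 := card_pts_le hW3
        refine (Finset.sum_le_card_nsmul _ w 3
          (fun x _ => by rcases hw x with h | h | h <;> omega)).trans ?_
        rw [smul_eq_mul]
        omega
    · have hsup := Submodule.finrank_sup_add_finrank_inf_eq W N
      have h4 : finrank F4 (W ⊔ N : Submodule F4 V) ≤ 4 := by omega
      refine ⟨pts (W ⊔ N), pts_mono le_sup_left hp, pts_mono le_sup_left hq,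
        pts_mono le_sup_left hr, ?_, ?_⟩
      · intro L hL x hx y hy hxy hxW hyW
        rcases (h𝓛 L).1 hL with ⟨hL1, -⟩ | rfl
        · exact subset_pts_of_mem_projLines hL1 hxy hx hy hxW hyW
        · exact pts_mono le_sup_right
      · have h85 := card_pts_le h4
        have hsub : pts N ⊆ pts (W ⊔ N) := pts_mono le_sup_right
        have h1 : ∑ x ∈ pts (W ⊔ N) \ pts N, w x = (pts (W ⊔ N) \ pts N).card := by
          rw [Finset.card_eq_sum_ones]
          exact Finset.sum_congr rfl fun x hx => hwN x (Finset.mem_sdiff.1 hx).2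
        have h2 := Finset.sum_sdiff (f := w) hsub
        have h3 := Finset.card_sdiff_add_card_eq_card hsub
        have h21 := card_pts_of_finrank_three hN
        omega

end Projective

/-! ### Points of weight zero and three -/

section Weights

open Projectivization Module
open scoped LinearAlgebra.Projectivization Classical

/-- Weight zero on `Z`, three on `T` and one elsewhere. -/
noncomputable def zeroThreeWeight {P : Type*} (Z T : Finset P) (p : P) : ℕ :=
  if p ∈ Z then 0 else if p ∈ T then 3 else 1

theorem zeroThreeWeight_mem {P : Type*} (Z T : Finset P) (p : P) :
    zeroThreeWeight Z T p = 0 ∨ zeroThreeWeight Z T p = 1 ∨ zeroThreeWeight Z T p = 3 := by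
  unfold zeroThreeWeight; split_ifs <;> simp

theorem sum_zeroThreeWeight {P : Type*} {Z T Y : Finset P} (hZT : Disjoint Z T) (hZ : Z ⊆ Y)
    (hT : T ⊆ Y) : ∑ p ∈ Y, zeroThreeWeight Z T p + Z.card = Y.card + 2 * T.card := by
  have h1 : Z.card = ∑ p ∈ Y, if p ∈ Z then 1 else 0 := by
    rw [← Finset.sum_filter, Finset.filter_mem_eq_inter, Finset.inter_eq_right.2 hZ,
      Finset.card_eq_sum_ones]
  have h2 : T.card = ∑ p ∈ Y, if p ∈ T then 1 else 0 := by
    rw [← Finset.sum_filter, Finset.filter_mem_eq_inter, Finset.inter_eq_right.2 hT,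
      Finset.card_eq_sum_ones]
  rw [h1, h2, Finset.card_eq_sum_ones, ← Finset.sum_add_distrib, Finset.mul_sum,
    ← Finset.sum_add_distrib]
  refine Finset.sum_congr rfl fun p _ => ?_
  have : p ∈ Z → p ∉ T := fun h => Finset.disjoint_left.1 hZT h
  unfold zeroThreeWeight
  split_ifs <;> simp_all

theorem filter_zeroThreeWeight_eq_three {P : Type*} {Z T : Finset P} (hZT : Disjoint Z T)
    (Y : Finset P) :
    Y.filter (fun p => zeroThreeWeight Z T p = 3) = Y.filter fun p => p ∈ T := by
  refine Finset.filter_congr fun p _ => ?_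
  have : p ∈ Z → p ∉ T := fun h => Finset.disjoint_left.1 hZT h
  unfold zeroThreeWeight
  split_ifs <;> simp_all

theorem card_filter_zeroThreeWeight_eq_one {P : Type*} {Z T : Finset P} (hZT : Disjoint Z T)
    (Y : Finset P) :
    (Y.filter fun p => zeroThreeWeight Z T p = 1).card + (Y.filter fun p => p ∈ Z).card +
      (Y.filter fun p => p ∈ T).card = Y.card := by
  rw [Finset.card_filter, Finset.card_filter, Finset.card_filter, Finset.card_eq_sum_ones,
    ← Finset.sum_add_distrib, ← Finset.sum_add_distrib]
  refine Finset.sum_congr rfl fun p _ => ?_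
  have : p ∈ Z → p ∉ T := fun h => Finset.disjoint_left.1 hZT h
  unfold zeroThreeWeight
  split_ifs <;> simp_all

variable {V : Type*} [AddCommGroup V] [Module F4 V] [Fintype V]

theorem HasDesign.of_zeroThreeWeight {Z T : Finset (ℙ F4 V)} (hZT : Disjoint Z T)
    (htable : ∀ W : Submodule F4 V, finrank F4 W = 2 → ∀ a,
      a + ((pts W).filter fun p => p ∈ Z).card + ((pts W).filter fun p => p ∈ T).card = 5 →
      HasTable ((pts W).filter fun p => p ∈ T).card a)
    {v : ℕ} (hv : v + Z.card = (Finset.univ : Finset (ℙ F4 V)).card + 2 * T.card) :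
    HasDesign v 63 := by
  have h := HasDesign.of_projective (V := V) (zeroThreeWeight Z T) (zeroThreeWeight_mem Z T)
    (fun W hW => by
      rw [filter_zeroThreeWeight_eq_three hZT]
      refine htable W hW _ ?_
      rw [card_filter_zeroThreeWeight_eq_one hZT, card_pts_of_finrank_two hW])
  have hs := sum_zeroThreeWeight hZT (Finset.subset_univ _) (Finset.subset_univ _)
  rwa [show ∑ p, zeroThreeWeight Z T p = v by omega] at h

/-- All points have weight one or three. -/
theorem HasDesign.of_three {s : ℕ} (hs : s ≤ (Finset.univ : Finset (ℙ F4 V)).card) :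
    HasDesign ((Finset.univ : Finset (ℙ F4 V)).card + 2 * s) 63 := by
  obtain ⟨T, -, rfl⟩ := Finset.exists_subset_card_eq hs
  refine HasDesign.of_zeroThreeWeight (Z := ∅) (T := T) (Finset.disjoint_empty_left _)
    (fun W _ a ha => ?_) (by simp)
  simp only [Finset.notMem_empty, Finset.filter_false, Finset.card_empty, add_zero] at ha
  generalize ((pts W).filter fun p => p ∈ T).card = b at ha
  obtain rfl : a = 5 - b := by omega
  have hb : b ≤ 5 := by omega
  interval_cases b
  · exact hasTable_0_5
  · exact hasTable_1_4
  · exact hasTable_2_3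
  · exact hasTable_3_2
  · exact hasTable_4_1
  · exact hasTable_5_0

/-- A plane with one point of weight zero and `k` points of weight three. -/
theorem HasDesign.of_plane {k : ℕ} (hk : k ≤ 5) (htable : HasTable k (20 - k))
    (hV : 3 ≤ finrank F4 V) {v : ℕ}
    (hv : v + 1 = (Finset.univ : Finset (ℙ F4 V)).card + 2 * k) : HasDesign v 94 := by
  obtain ⟨f, hf⟩ := exists_linearIndependent_of_le_finrank hV
  let N : Submodule F4 V := Submodule.span F4 (Set.range f)
  have hN : finrank F4 N = 3 := by
    have := finrank_span_eq_card hf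
    simpa using this
  have h21 := card_pts_of_finrank_three hN
  obtain ⟨Z, hZN, hZ⟩ := Finset.exists_subset_card_eq (s := pts N) (n := 1) (by omega)
  obtain ⟨T, hTN, hT⟩ := Finset.exists_subset_card_eq (s := pts N \ Z) (n := k)
    (by rw [Finset.card_sdiff_of_subset hZN]; omega)
  have hZT : Disjoint Z T := Finset.disjoint_left.2 fun p hp hp' =>
    (Finset.mem_sdiff.1 (hTN hp')).2 hp
  have hTN' : T ⊆ pts N := hTN.trans Finset.sdiff_subset
  have hs := sum_zeroThreeWeight hZT (Finset.subset_univ _) (Finset.subset_univ _)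
  have hs' := sum_zeroThreeWeight hZT hZN hTN'
  have hc1 := card_filter_zeroThreeWeight_eq_one hZT (pts N)
  have hc3 := filter_zeroThreeWeight_eq_three hZT (pts N)
  rw [Finset.filter_mem_eq_inter, Finset.filter_mem_eq_inter, Finset.inter_eq_right.2 hZN,
    Finset.inter_eq_right.2 hTN', h21, hZ, hT] at hc1
  rw [Finset.filter_mem_eq_inter, Finset.inter_eq_right.2 hTN'] at hc3
  have h := HasDesign.of_projective_plane (V := V) (zeroThreeWeight Z T)
    (zeroThreeWeight_mem Z T) N hN (fun p hp => by
      unfold zeroThreeWeight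
      rw [if_neg fun h => hp (hZN h), if_neg fun h => hp (hTN' h)]) (by omega)
    (by
      rw [hc3, hT]
      convert htable using 1
      omega)
  rwa [show ∑ p, zeroThreeWeight Z T p = v by omega] at h

end Weights

/-! ### Vectors with a distinguished first coordinate -/

theorem card_filter_tail {D : ℕ} (B : F4 → Finset (Fin D → F4)) :
    (Finset.univ.filter fun x : Fin (D + 1) → F4 => Fin.tail x ∈ B (x 0)).card =
      ∑ a, (B a).card := by
  rw [Finset.card_eq_sum_card_fiberwise (f := fun x => x 0) (t := Finset.univ)
    (fun x _ => Finset.mem_univ _)]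
  refine Finset.sum_congr rfl fun a _ => ?_
  symm
  refine Finset.card_bij (fun y _ => Fin.cons a y) ?_ ?_ ?_
  · intro y hy
    simpa using hy
  · intro y _ z _ h
    exact (Fin.cons_right_injective (α := fun _ => F4) a) h
  · intro x hx
    simp only [Finset.mem_filter, Finset.mem_univ, true_and] at hx
    obtain ⟨hx, rfl⟩ := hx
    exact ⟨Fin.tail x, hx, Fin.cons_self_tail x⟩

theorem tail_add_smul {D : ℕ} (x y : Fin (D + 1) → F4) (t : F4) :
    Fin.tail (y + t • x) = Fin.tail y + t • Fin.tail x := rfl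

theorem eq_zero_of_tail {D : ℕ} {x : Fin (D + 1) → F4} (h0 : x 0 = 0) (h : Fin.tail x = 0) :
    x = 0 := by
  rw [← Fin.cons_self_tail x, h0, h]
  ext i
  refine Fin.cases ?_ (fun j => ?_) i <;> simp

/-! ### Subsets of projective spaces without secants of size two -/

/-- The vectors spanning fourteen points of the plane that meet no line in exactly two points. -/
def fourteenSet (a b c : F4) : Bool :=
  (a != 0 && (b != 0 || c == 0)) || (a == 0 && b != 0 && c == 0)

theorem fourteenSet_smul : ∀ c : F4, c ≠ 0 → ∀ x y z, fourteenSet x y z = true →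
    fourteenSet (c * x) (c * y) (c * z) = true := by
  decide +kernel

set_option synthInstance.maxHeartbeats 200000 in
set_option synthInstance.maxSize 1000 in
theorem fourteenSet_secant : ∀ x y z x' y' z' : F4, fourteenSet x y z = true →
    fourteenSet x' y' z' = true → (∀ c : F4, ¬ (x' = c * x ∧ y' = c * y ∧ z' = c * z)) →
    ∃ t : F4, t ≠ 0 ∧ fourteenSet (x' + t * x) (y' + t * y) (z' + t * z) = true := by
  decide +kernel

theorem card_fourteenSet : (Finset.univ.filter fun x : Fin 3 → F4 =>
    fourteenSet (x 0) (x 1) (x 2) = true).card = 3 * 14 := by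
  decide +kernel

section GoodSets

open Projectivization Module
open scoped LinearAlgebra.Projectivization Classical

/-- There is a set of `v` points of the projective space of dimension `D` over the field with
four elements that meets no line in exactly two points; it is given by its spanning vectors. -/
def HasNoTwoSecantSet (D v : ℕ) : Prop :=
  ∃ S : (Fin (D + 1) → F4) → Prop, (Finset.univ.filter S).card = 3 * v ∧ ¬ S 0 ∧
    (∀ c : F4, c ≠ 0 → ∀ x, S x → S (c • x)) ∧
    ∀ x y, S x → S y → (∀ c : F4, y ≠ c • x) → ∃ t : F4, t ≠ 0 ∧ S (y + t • x)

theorem HasNoTwoSecantSet.hasDesign {D v : ℕ} (h : HasNoTwoSecantSet D v) : HasDesign v 63 := by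
  obtain ⟨S, hcard, h0, hsmul, hsec⟩ := h
  have hSv : (pointsOf S).card = v := by
    have := card_pointsOf hsmul h0
    omega
  refine HasDesign.of_zeroThreeWeight (Z := Finset.univ \ pointsOf S) (T := ∅)
    (Finset.disjoint_empty_right _) (fun W hW a ha => ?_) ?_
  · simp only [Finset.notMem_empty, Finset.filter_false, Finset.card_empty, add_zero] at ha ⊢
    have h5 := Finset.card_filter_add_card_filter_not (s := pts W) (fun p => p ∈ pointsOf S)
    simp only [Finset.mem_sdiff, Finset.mem_univ, true_and] at ha
    rw [card_pts_of_finrank_two hW] at h5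
    have ha' : ((pts W).filter fun p => p ∈ pointsOf S).card = a := by omega
    have h2 : a ≠ 2 := by
      rintro rfl
      obtain ⟨p, q, hpq, hset⟩ := Finset.card_eq_two.1 ha'
      have hmem : ∀ r, r ∈ pts W ∧ r ∈ pointsOf S ↔ r = p ∨ r = q := by
        intro r
        rw [← Finset.mem_filter, hset, Finset.mem_insert, Finset.mem_singleton]
      obtain ⟨hpW, hpS⟩ := (hmem p).2 (Or.inl rfl)
      obtain ⟨hqW, hqS⟩ := (hmem q).2 (Or.inr rfl)
      have hind : ∀ c : F4, q.rep ≠ c • p.rep := fun c hc => hpq <| by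
        rw [← mk_rep p, ← mk_rep q]
        exact ((mk_eq_mk_iff' F4 _ _ q.rep_nonzero p.rep_nonzero).2 ⟨c, hc.symm⟩).symm
      obtain ⟨t, ht, hS⟩ := hsec _ _ (mem_pointsOf.1 hpS) (mem_pointsOf.1 hqS) hind
      have hne : q.rep + t • p.rep ≠ 0 := by intro h; rw [h] at hS; exact h0 hS
      have hW' : mk F4 _ hne ∈ pts W :=
        (mk_mem_pts hne).2 (W.add_mem (rep_mem_iff.2 hqW) (W.smul_mem _ (rep_mem_iff.2 hpW)))
      rcases (hmem _).1 ⟨hW', (mk_mem_pointsOf hsmul hne).2 hS⟩ with h | h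
      · obtain ⟨c, hc⟩ := (mk_eq_mk_iff' F4 _ _ hne p.rep_nonzero).1 (h.trans (mk_rep p).symm)
        exact hind (c - t) (by rw [sub_smul, hc, add_sub_cancel_right])
      · obtain ⟨c, hc⟩ := (mk_eq_mk_iff' F4 _ _ hne q.rep_nonzero).1 (h.trans (mk_rep q).symm)
        refine hpq ?_
        rw [← mk_rep p, ← mk_rep q, mk_eq_mk_iff']
        refine ⟨t⁻¹ * (c - 1), ?_⟩
        rw [mul_smul, sub_smul, hc, one_smul, add_sub_cancel_left, smul_smul,
          inv_mul_cancel₀ ht, one_smul]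
    have h5' : a ≤ 5 := by omega
    interval_cases a
    · exact hasTable_0_0
    · exact hasTable_0_1
    · exact absurd rfl h2
    · exact hasTable_0_3
    · exact hasTable_0_4
    · exact hasTable_0_5
  · rw [Finset.card_sdiff_of_subset (Finset.subset_univ _), hSv]
    have := Finset.card_le_univ (pointsOf S)
    simp only [Finset.card_empty, Finset.card_univ]
    omega

/-- There is a set of `z` vectors of dimension `D` that meets no affine line in exactly three
points. -/
def HasNoThreeSecantSet (D z : ℕ) : Prop :=
  ∃ A : Finset (Fin D → F4), A.card = z ∧
    ∀ u d, d ≠ 0 → (∀ t : F4, t ≠ 0 → u + t • d ∈ A) → u ∈ A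

theorem HasNoThreeSecantSet.empty (D : ℕ) : HasNoThreeSecantSet D 0 :=
  ⟨∅, rfl, fun _ _ _ h => absurd (h 1 one_ne_zero) (Finset.notMem_empty _)⟩

theorem HasNoThreeSecantSet.singleton (D : ℕ) : HasNoThreeSecantSet D 1 := by
  have h0 : ∀ a b : F4, (∀ t : F4, t ≠ 0 → a + t * b = 0) → b = 0 := by decide
  refine ⟨{0}, rfl, fun u d hd h => absurd (funext fun i => h0 (u i) (d i) fun t ht => ?_) hd⟩
  exact congrFun (Finset.mem_singleton.1 (h t ht)) i

theorem card_vectors (D : ℕ) : (Finset.univ : Finset (Fin D → F4)).card = 4 ^ D := by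
  rw [Finset.card_univ, Fintype.card_fun, Fintype.card_fin, F4.card_eq]

theorem HasNoThreeSecantSet.univ (D : ℕ) : HasNoThreeSecantSet D (4 ^ D) :=
  ⟨Finset.univ, card_vectors D, fun _ _ _ _ => Finset.mem_univ _⟩

theorem HasNoThreeSecantSet.slab (D : ℕ) : HasNoThreeSecantSet (D + 1) (2 * 4 ^ D) := by
  have h01 : ∀ a b : F4, (∀ t : F4, t ≠ 0 → a + t * b = 0 ∨ a + t * b = 1) → a = 0 ∨ a = 1 := by
    decide
  let B : F4 → Finset (Fin D → F4) := fun a => if a = 0 ∨ a = 1 then Finset.univ else ∅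
  have hB : ∀ a y, y ∈ B a ↔ a = 0 ∨ a = 1 := by
    intro a y
    by_cases h : a = 0 ∨ a = 1 <;> simp [B, h]
  refine ⟨Finset.univ.filter fun x => Fin.tail x ∈ B (x 0), ?_, ?_⟩
  · rw [card_filter_tail]
    have : ∀ a, (B a).card = if a = 0 ∨ a = 1 then 4 ^ D else 0 := by
      intro a
      by_cases h : a = 0 ∨ a = 1 <;> simp [B, h, card_vectors, -Finset.card_univ]
    simp only [this]
    rw [← Finset.sum_filter, Finset.sum_const, smul_eq_mul]
    congr 1
  · intro u d _ h
    simp only [Finset.mem_filter, Finset.mem_univ, true_and, hB] at h ⊢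
    exact h01 _ _ h

/-- The incidence vector of a hyperoval of the affine plane of order four. -/
def hyperoval (a b : F4) (s : Fin 6 → ℕ) : ℕ :=
  (![![s 0, s 1, 0, 0], ![s 2, 0, s 3, 0], ![0, s 4, s 5, 0], ![0, 0, 0, 0]] :
    Fin 4 → Fin 4 → ℕ) a b

theorem HasNoThreeSecantSet.hyperoval {D : ℕ} {s : Fin 6 → ℕ}
    (hs : ∀ i, HasNoThreeSecantSet D (s i)) : HasNoThreeSecantSet (D + 2) (∑ i, s i) := by
  have hF : ∀ a b : F4, HasNoThreeSecantSet D (_root_.hyperoval a b s) := by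
    have h0 := HasNoThreeSecantSet.empty D
    intro a b
    change Fin 4 at a b
    fin_cases a <;> fin_cases b <;> first | exact hs _ | exact h0
  have hO : ∀ a b c d : F4, (∀ t : F4, t ≠ 0 →
      _root_.hyperoval (a + t * c) (b + t * d) (fun _ => 1) ≠ 0) → c = 0 ∧ d = 0 := by
    decide +kernel
  have hO' : ∀ a b, _root_.hyperoval a b s ≠ 0 → _root_.hyperoval a b (fun _ => 1) ≠ 0 := by
    intro a b
    change Fin 4 at a b
    fin_cases a <;> fin_cases b <;> simp [_root_.hyperoval]
  choose F hF1 hF2 using hF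
  refine ⟨Finset.univ.filter fun x : Fin (D + 2) → F4 => Fin.tail x ∈
    (Finset.univ.filter fun y : Fin (D + 1) → F4 => Fin.tail y ∈ F (x 0) (y 0)), ?_, ?_⟩
  · rw [card_filter_tail fun a =>
      Finset.univ.filter fun y : Fin (D + 1) → F4 => Fin.tail y ∈ F a (y 0)]
    simp only [card_filter_tail, hF1]
    have : ∑ a : F4, ∑ b : F4, _root_.hyperoval a b s =
      ∑ a : Fin 4, ∑ b : Fin 4, _root_.hyperoval a b s := rfl
    rw [this]
    simp [_root_.hyperoval, Fin.sum_univ_succ]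
    ring
  · intro u d hd h
    simp only [Finset.mem_filter, Finset.mem_univ, true_and] at h ⊢
    have h0 : d 0 = 0 ∧ Fin.tail d 0 = 0 := by
      refine hO (u 0) (Fin.tail u 0) _ _ fun t ht => hO' _ _ ?_
      have := h t ht
      rw [← hF1]
      exact Finset.card_ne_zero_of_mem this
    have hd' : Fin.tail (Fin.tail d) ≠ 0 := fun h' =>
      hd (eq_zero_of_tail h0.1 (eq_zero_of_tail h0.2 h'))
    refine hF2 _ _ _ _ hd' fun t ht => ?_
    have := h t ht
    simp only [tail_add_smul] at this
    simpa only [Pi.add_apply, Pi.smul_apply, h0.1, h0.2, smul_zero, add_zero] using this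

theorem hasNoThreeSecantSet (D : ℕ) {z : ℕ} (hz : z ≤ 4 ^ D) : HasNoThreeSecantSet (D + 1) z := by
  induction D using Nat.strong_induction_on generalizing z with
  | _ D ih =>
    match D, ih with
    | 0, _ =>
      obtain rfl | rfl : z = 0 ∨ z = 1 := by omega
      · exact .empty 1
      · exact .singleton 1
    | 1, _ =>
      have h : ∀ b : ℕ → Prop, ∀ (_ : DecidablePred b),
          HasNoThreeSecantSet 2 (∑ i : Fin 6, if b i then 1 else 0) := by
        intro b _
        refine HasNoThreeSecantSet.hyperoval (D := 0) fun i => ?_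
        split_ifs
        · exact .singleton 0
        · exact .empty 0
      have := h (fun i => i < z) inferInstance
      convert this using 1
      interval_cases z <;> rfl
    | D + 2, ih =>
      set u := 4 ^ D with hu
      have hu1 : 4 ^ (D + 2) = 16 * u := by rw [hu]; ring
      have hfull : HasNoThreeSecantSet (D + 1) (4 * u) := by
        have := HasNoThreeSecantSet.univ (D + 1)
        rwa [pow_succ, mul_comm] at this
      have hhalf : HasNoThreeSecantSet (D + 1) (2 * u) := .slab D
      have hsmall : ∀ z ≤ u, HasNoThreeSecantSet (D + 1) z := fun z hz => ih D (by omega) hz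
      have hzero := HasNoThreeSecantSet.empty (D + 1)
      have key : ∀ s0 s1 s2 s3 s4 s5 : ℕ, HasNoThreeSecantSet (D + 1) s0 →
          HasNoThreeSecantSet (D + 1) s1 → HasNoThreeSecantSet (D + 1) s2 →
          HasNoThreeSecantSet (D + 1) s3 → HasNoThreeSecantSet (D + 1) s4 →
          HasNoThreeSecantSet (D + 1) s5 →
          HasNoThreeSecantSet (D + 3) (s0 + s1 + s2 + s3 + s4 + s5) := by
        intro s0 s1 s2 s3 s4 s5 h0 h1 h2 h3 h4 h5
        have := HasNoThreeSecantSet.hyperoval (D := D + 1) (s := ![s0, s1, s2, s3, s4, s5])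
          (fun i => by fin_cases i <;> assumption)
        convert this using 1
        simp [Fin.sum_univ_succ]
        ring
      have peel : ∀ c k z : ℕ, HasNoThreeSecantSet (D + 1) c → c ≤ k → z ≤ c + k →
          ∃ s, HasNoThreeSecantSet (D + 1) s ∧ ∃ y ≤ k, z = s + y := by
        intro c k z hc hck hz
        by_cases h : c ≤ z
        · exact ⟨c, hc, z - c, by omega, by omega⟩
        · exact ⟨0, hzero, z, by omega, by omega⟩
      obtain ⟨s0, h0, z, hz0, rfl⟩ := peel (4 * u) (12 * u) z hfull (by omega) (by omega)
      obtain ⟨s1, h1, z, hz1, rfl⟩ := peel (4 * u) (8 * u) z hfull (by omega) (by omega)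
      obtain ⟨s2, h2, z, hz2, rfl⟩ := peel (4 * u) (4 * u) z hfull (by omega) (by omega)
      obtain ⟨s3, h3, z, hz3, rfl⟩ := peel (2 * u) (2 * u) z hhalf (by omega) (by omega)
      obtain ⟨s4, h4, z, hz4, rfl⟩ := peel u u z (hsmall u le_rfl) le_rfl (by omega)
      have := key s0 s1 s2 s3 s4 z h0 h1 h2 h3 h4 (hsmall z hz4)
      convert this using 1
      omega

/-- Remove the affine points of a set without secants of size three. -/
theorem HasNoThreeSecantSet.hasNoTwoSecantSet {D z v : ℕ} (h : HasNoThreeSecantSet D z)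
    (hv : 3 * (v + z) + 1 = 4 ^ (D + 1)) : HasNoTwoSecantSet D v := by
  obtain ⟨A, rfl, hA⟩ := h
  let Z : (Fin (D + 1) → F4) → Prop := fun x => x 0 ≠ 0 ∧ (x 0)⁻¹ • Fin.tail x ∈ A
  have hZ : ∀ c : F4, c ≠ 0 → ∀ x, Z (c • x) ↔ Z x := by
    intro c hc x
    have h1 : (c • x) 0 = c * x 0 := rfl
    have h2 : Fin.tail (c • x) = c • Fin.tail x := rfl
    simp only [Z, h1, h2, smul_smul, mul_inv, mul_ne_zero_iff]
    rw [show c⁻¹ * (x 0)⁻¹ * c = (x 0)⁻¹ by field_simp]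
    simp [hc]
  have hZcard : (Finset.univ.filter Z).card = 3 * A.card := by
    let B : F4 → Finset (Fin D → F4) := fun a =>
      Finset.univ.filter fun y => a ≠ 0 ∧ a⁻¹ • y ∈ A
    have h1 : Finset.univ.filter Z =
        Finset.univ.filter fun x : Fin (D + 1) → F4 => Fin.tail x ∈ B (x 0) := by
      ext x; simp [Z, B]
    have h2 : ∀ a, (B a).card = if a ≠ 0 then A.card else 0 := by
      intro a
      by_cases ha : a = 0
      · simp [B, ha]
      · rw [if_pos ha]
        refine Finset.card_bij (fun y _ => a⁻¹ • y) (fun y hy => ?_) (fun y _ z _ h => ?_)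
          (fun y hy => ⟨a • y, ?_, ?_⟩)
        · simp only [B, Finset.mem_filter] at hy
          exact hy.2.2
        · exact smul_right_injective _ (inv_ne_zero ha) h
        · simp [B, ha, smul_smul, hy]
        · simp [smul_smul, ha]
    rw [h1, card_filter_tail]
    simp only [h2]
    rw [← Finset.sum_filter, Finset.sum_const, smul_eq_mul]
    congr 1
  refine ⟨fun x => x ≠ 0 ∧ ¬ Z x, ?_, fun h => h.1 rfl,
    fun c hc x hx => ⟨smul_ne_zero hc hx.1, fun h => hx.2 ((hZ c hc x).1 h)⟩, ?_⟩
  · have h1 := Finset.card_filter_add_card_filter_not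
      (s := (Finset.univ : Finset (Fin (D + 1) → F4))) Z
    have h3 : (0 : Fin (D + 1) → F4) ∈ Finset.univ.filter fun x => ¬ Z x := by simp [Z]
    have h4 := Finset.card_erase_add_one h3
    rw [card_vectors, hZcard] at h1
    have h2 : (Finset.univ.filter fun x : Fin (D + 1) → F4 => x ≠ 0 ∧ ¬ Z x).card =
        ((Finset.univ.filter fun x => ¬ Z x).erase 0).card := by
      congr 1; ext x; simp
    refine Eq.trans ?_ (h2.trans ?_)
    · congr!
    · omega
  · rintro x y ⟨hx0, hxZ⟩ ⟨hy0, hyZ⟩ hxy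
    by_contra! hcon
    have hall : ∀ t : F4, t ≠ 0 → Z (y + t • x) := by
      intro t ht
      refine hcon t ht fun h => hxy (-t) ?_
      rw [neg_smul]
      exact eq_neg_of_add_eq_zero_left h
    have hfirst : ∀ a b : F4, (∀ t : F4, t ≠ 0 → b + t * a ≠ 0) → a = 0 ∧ b ≠ 0 ∨ a ≠ 0 ∧ b = 0 := by
      decide
    rcases hfirst (x 0) (y 0) (fun t ht => (hall t ht).1) with ⟨hx, hy⟩ | ⟨hx, hy⟩
    · refine hyZ ⟨hy, hA _ ((y 0)⁻¹ • Fin.tail x) ?_ fun t ht => ?_⟩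
      · exact smul_ne_zero (inv_ne_zero hy) fun h => hx0 (eq_zero_of_tail hx h)
      · have h1 : (y + t • x) 0 = y 0 := by simp [hx]
        have h2 := (hall t ht).2
        rw [h1, tail_add_smul, smul_add] at h2
        rwa [smul_comm t]
    · refine hxZ ⟨hx, hA _ ((x 0)⁻¹ • Fin.tail y) ?_ fun t ht => ?_⟩
      · exact smul_ne_zero (inv_ne_zero hx) fun h => hy0 (eq_zero_of_tail hy h)
      · have h1 : (y + t⁻¹ • x) 0 = t⁻¹ * x 0 := by simp [hy]
        have h2 := (hall t⁻¹ (inv_ne_zero ht)).2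
        rw [h1, tail_add_smul, smul_add, mul_inv, inv_inv, smul_smul] at h2
        rw [mul_right_comm, mul_inv_cancel₀ ht, one_mul] at h2
        rwa [smul_smul, add_comm]

/-- Extend a set by the points off two hyperplanes. -/
theorem HasNoTwoSecantSet.extend {D v : ℕ} (h : HasNoTwoSecantSet D v) :
    HasNoTwoSecantSet (D + 1) (3 * 4 ^ D + v) := by
  obtain ⟨S, hcard, h0, hsmul, hsec⟩ := h
  refine ⟨fun x => (x 0 ≠ 0 ∧ Fin.tail x 0 ≠ 0) ∨ (x 0 = 0 ∧ S (Fin.tail x)), ?_, ?_, ?_, ?_⟩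
  · let B : F4 → Finset (Fin (D + 1) → F4) := fun a =>
      if a = 0 then Finset.univ.filter S else Finset.univ.filter fun y => y 0 ≠ 0
    have h1 : (Finset.univ.filter fun x : Fin (D + 2) → F4 =>
        (x 0 ≠ 0 ∧ Fin.tail x 0 ≠ 0) ∨ (x 0 = 0 ∧ S (Fin.tail x))) =
        Finset.univ.filter fun x : Fin (D + 2) → F4 => Fin.tail x ∈ B (x 0) := by
      ext x
      by_cases hx : x 0 = 0 <;> simp [B, hx]
    have h2 : (Finset.univ.filter fun y : Fin (D + 1) → F4 => y 0 ≠ 0).card = 3 * 4 ^ D := by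
      have h3 := card_filter_tail (D := D) fun a => if a ≠ 0 then Finset.univ else ∅
      have h4 : ∀ a : F4, (if a ≠ 0 then Finset.univ else ∅ : Finset (Fin D → F4)).card =
          if a ≠ 0 then 4 ^ D else 0 := by
        intro a
        by_cases ha : a = 0 <;> simp [ha, card_vectors, -Finset.card_univ]
      simp only [h4] at h3
      rw [← Finset.sum_filter, Finset.sum_const, smul_eq_mul] at h3
      refine Eq.trans ?_ (h3.trans ?_)
      · congr 1
        ext y
        by_cases hy : y 0 = 0 <;> simp [hy]
      · congr 1
    have h5 : ∀ a, (B a).card = (if a = 0 then 3 * v else 0) + if a ≠ 0 then 3 * 4 ^ D else 0 := by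
      intro a
      by_cases ha : a = 0
      · simp [B, ha, hcard]
      · simp [B, ha, h2]
    refine Eq.trans (by congr!) ((congrArg Finset.card h1).trans ?_)
    rw [card_filter_tail]
    simp only [h5]
    rw [Finset.sum_add_distrib, ← Finset.sum_filter, ← Finset.sum_filter, Finset.sum_const,
      Finset.sum_const, smul_eq_mul, smul_eq_mul]
    have h6 : (Finset.univ.filter fun a : F4 => a = 0).card = 1 := by decide
    have h7 : (Finset.univ.filter fun a : F4 => a ≠ 0).card = 3 := by decide
    rw [h6, h7]
    ring
  · rintro (⟨h, -⟩ | ⟨-, h⟩)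
    · exact h rfl
    · exact h0 h
  · rintro c hc x (⟨h1, h2⟩ | ⟨h1, h2⟩)
    · exact Or.inl ⟨mul_ne_zero hc h1, mul_ne_zero hc h2⟩
    · exact Or.inr ⟨by simp [h1], hsmul c hc _ h2⟩
  · intro x y hx hy hxy
    by_cases h : x 0 = 0 ∧ y 0 = 0
    · obtain ⟨t, ht, hS⟩ := hsec (Fin.tail x) (Fin.tail y) (hx.resolve_left fun h' => h'.1 h.1).2
        (hy.resolve_left fun h' => h'.1 h.2).2 fun c hc => hxy c (by
          rw [← sub_eq_zero]
          refine eq_zero_of_tail (by simp [h.1, h.2]) ?_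
          change Fin.tail y - c • Fin.tail x = 0
          rw [hc, sub_self])
      exact ⟨t, ht, Or.inr ⟨by simp [h.1, h.2], hS⟩⟩
    · have key : ∀ a b c d : F4, ¬ (a = 0 ∧ b = 0) → ¬ (c = 0 ∧ d = 0) →
          ∃ t : F4, t ≠ 0 ∧ b + t * a ≠ 0 ∧ d + t * c ≠ 0 := by
        decide +kernel
      have h' : ¬ (Fin.tail x 0 = 0 ∧ Fin.tail y 0 = 0) := by
        rintro ⟨h1, h2⟩
        exact h ⟨(hx.resolve_left fun h' => h'.2 h1).1, (hy.resolve_left fun h' => h'.2 h2).1⟩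
      obtain ⟨t, ht, h1, h2⟩ := key _ _ _ _ h h'
      exact ⟨t, ht, Or.inl ⟨h1, h2⟩⟩

theorem hasNoTwoSecantSet_of_le (D : ℕ) {v : ℕ} (h1 : 4 ^ (D + 1) ≤ v)
    (h2 : 3 * v + 1 ≤ 4 ^ (D + 2)) : HasNoTwoSecantSet (D + 1) v := by
  induction D generalizing v with
  | zero =>
    refine (hasNoThreeSecantSet 0 (z := 5 - v) ?_).hasNoTwoSecantSet ?_
    all_goals norm_num at h1 h2 ⊢
    all_goals omega
  | succ D ih =>
    have h4 : 4 ^ (D + 2) = 4 * 4 ^ (D + 1) := by ring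
    have h5 : 4 ^ (D + 3) = 16 * 4 ^ (D + 1) := by ring
    have h6 : 4 ^ (D + 1 + 1 + 1) = 16 * 4 ^ (D + 1) := by ring
    have h7 : 4 ^ (D + 1 + 2) = 16 * 4 ^ (D + 1) := by ring
    have h8 : 4 ^ (D + 1 + 1) = 4 * 4 ^ (D + 1) := by ring
    by_cases h : 4 ^ (D + 3) ≤ 3 * (v + 4 ^ (D + 1)) + 1
    · obtain ⟨z, hz⟩ : ∃ z, 3 * (v + z) + 1 = 4 ^ (D + 1 + 1 + 1) := by
        have : (4 ^ (D + 3)) % 3 = 1 := by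
          rw [Nat.pow_mod]; simp
        exact ⟨(4 ^ (D + 3) - 1) / 3 - v, by omega⟩
      exact (hasNoThreeSecantSet (D + 1) (z := z) (by omega)).hasNoTwoSecantSet hz
    · have := (ih (v := v - 3 * 4 ^ (D + 1)) (by omega) (by omega)).extend
      convert this using 1
      omega

theorem hasNoTwoSecantSet_fourteen : HasNoTwoSecantSet 2 14 := by
  refine ⟨fun x => fourteenSet (x 0) (x 1) (x 2) = true, ?_, ?_,
    fun c hc x hx => fourteenSet_smul c hc _ _ _ hx, ?_⟩
  · refine Eq.trans ?_ card_fourteenSet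
    congr!
  · exact Bool.false_ne_true
  · intro x y hx hy hxy
    refine fourteenSet_secant _ _ _ _ _ _ hx hy fun c hc => hxy c (funext fun i => ?_)
    fin_cases i
    · exact hc.1
    · exact hc.2.1
    · exact hc.2.2

theorem hasNoTwoSecantSet_sub_two (D : ℕ) : HasNoTwoSecantSet (D + 2) (4 ^ (D + 2) - 2) := by
  induction D with
  | zero => exact hasNoTwoSecantSet_fourteen
  | succ D ih =>
    convert ih.extend using 1
    have h1 : 4 ^ (D + 1 + 2) = 16 * 4 ^ (D + 1) := by ring
    have h2 : 4 ^ (D + 2) = 4 * 4 ^ (D + 1) := by ring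
    have h3 : 0 < 4 ^ (D + 1) := by positivity
    omega

end GoodSets

/-! ### Cones with a vertex of weight zero -/

section Cones

open Projectivization Module
open scoped LinearAlgebra.Projectivization Classical

theorem mem_coneOver_smul_iff {V : Type*} [AddCommGroup V] [Module F4 V] [Fintype V]
    {C : Finset (ℙ F4 V)} {c : F4} (hc : c ≠ 0) {x : V} :
    c • x ∈ coneOver C ↔ x ∈ coneOver C := by
  refine ⟨fun h => ?_, smul_mem_coneOver hc⟩
  have := smul_mem_coneOver (inv_ne_zero hc) h
  rwa [smul_smul, inv_mul_cancel₀ hc, one_smul] at this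

theorem cons_one_ne_zero (D : ℕ) : (Fin.cons 1 0 : Fin (D + 1) → F4) ≠ 0 := fun h =>
  one_ne_zero (congrFun h 0)

/-- A vertex of weight zero over a base with `i` points whose lines to the vertex have all other
points of weight three, and `j` points whose lines to the vertex have three such points. -/
theorem HasDesign.of_cone {D i j v : ℕ}
    (hij : i + j ≤ (Finset.univ : Finset (ℙ F4 (Fin D → F4))).card)
    (hv : v + 1 = (Finset.univ : Finset (ℙ F4 (Fin (D + 1) → F4))).card + 2 * (4 * i + 3 * j)) :
    HasDesign v 63 := by
  obtain ⟨C, -, hC⟩ := Finset.exists_subset_card_eq hij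
  obtain ⟨C4, hC4C, hC4⟩ := Finset.exists_subset_card_eq (s := C) (n := i) (by omega)
  obtain ⟨C3, hC3⟩ : ∃ C3, C3 = C \ C4 := ⟨_, rfl⟩
  have hC3card : C3.card = j := by
    rw [hC3, Finset.card_sdiff_of_subset hC4C]; omega
  have hdisj : ∀ y, y ∈ coneOver C3 → y ∉ coneOver C4 := by
    intro y h3 h4
    obtain ⟨h, h3⟩ := mem_coneOver.1 h3
    obtain ⟨_, h4⟩ := mem_coneOver.1 h4
    rw [hC3] at h3
    exact (Finset.mem_sdiff.1 h3).2 h4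
  have hzero : ∀ C : Finset (ℙ F4 (Fin D → F4)), (0 : Fin D → F4) ∉ coneOver C := fun C h =>
    (mem_coneOver.1 h).1 rfl
  let S : (Fin (D + 1) → F4) → Prop := fun x =>
    Fin.tail x ∈ coneOver C4 ∨ x 0 ≠ 0 ∧ Fin.tail x ∈ coneOver C3
  have hSsmul : ∀ c : F4, c ≠ 0 → ∀ x, S x → S (c • x) := by
    rintro c hc x (h | ⟨h1, h2⟩)
    · exact Or.inl (smul_mem_coneOver hc h)
    · exact Or.inr ⟨mul_ne_zero hc h1, smul_mem_coneOver hc h2⟩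
  have hS0 : ¬ S 0 := by
    rintro (h | ⟨h, -⟩)
    · exact hzero _ h
    · exact h rfl
  have hScard : (Finset.univ.filter S).card = 3 * (4 * i + 3 * j) := by
    let B : F4 → Finset (Fin D → F4) := fun a =>
      if a = 0 then coneOver C4 else coneOver C4 ∪ coneOver C3
    have h1 : (Finset.univ.filter S) =
        Finset.univ.filter fun x : Fin (D + 1) → F4 => Fin.tail x ∈ B (x 0) := by
      ext x
      by_cases hx : x 0 = 0 <;> simp [S, B, hx]
    have h2 : ∀ a, (B a).card = 3 * i + if a ≠ 0 then 3 * j else 0 := by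
      intro a
      by_cases ha : a = 0
      · simp [B, ha, card_coneOver, hC4]
      · simp only [B, if_neg ha, if_pos ha, ne_eq]
        rw [Finset.card_union_of_disjoint (Finset.disjoint_left.2 fun y h4 h3 => hdisj y h3 h4),
          card_coneOver, card_coneOver, hC4, hC3card]
    have h3 : (Finset.univ.filter fun a : F4 => a ≠ 0).card = 3 := by decide
    rw [h1, card_filter_tail]
    simp only [h2]
    rw [Finset.sum_add_distrib, ← Finset.sum_filter, Finset.sum_const, Finset.sum_const, h3,
      Finset.card_univ, F4.card_eq, smul_eq_mul, smul_eq_mul]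
    ring
  have hT : (pointsOf S).card = 4 * i + 3 * j := by
    have := (card_pointsOf hSsmul hS0).trans (Eq.trans (by congr!) hScard)
    omega
  let p0 := mk F4 _ (cons_one_ne_zero D)
  have hp0T : p0 ∉ pointsOf S := by
    rw [mk_mem_pointsOf hSsmul]
    rintro (h | ⟨-, h⟩) <;> exact hzero _ h
  refine HasDesign.of_zeroThreeWeight (Z := {p0}) (T := pointsOf S)
    (Finset.disjoint_singleton_left.2 hp0T) (fun W hW a ha => ?_) (by
      rw [Finset.card_singleton, hT]; exact hv)
  by_cases hp0 : p0 ∈ pts W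
  · have h5 := card_pts_of_finrank_two hW
    have hZ : ((pts W).filter fun p => p ∈ ({p0} : Finset _)).card = 1 := by
      rw [Finset.filter_mem_eq_inter,
        Finset.inter_eq_right.2 (Finset.singleton_subset_iff.2 hp0), Finset.card_singleton]
    rw [hZ] at ha
    have herase : ((pts W).erase p0).card = 4 := by rw [Finset.card_erase_of_mem hp0, h5]
    obtain ⟨q, hq⟩ := Finset.card_pos.1 (by omega : 0 < ((pts W).erase p0).card)
    obtain ⟨hqp0, hqW⟩ := Finset.mem_erase.1 hq
    set x := q.rep with hx
    have hx0 : Fin.tail x ≠ 0 := by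
      intro h
      refine hqp0 ?_
      rw [← mk_rep q]
      refine (mk_eq_mk_iff' F4 _ _ _ _).2 ⟨x 0, ?_⟩
      rw [← hx, ← sub_eq_zero]
      refine eq_zero_of_tail (by simp) ?_
      change x 0 • (0 : Fin D → F4) - Fin.tail x = 0
      rw [h, smul_zero, sub_zero]
    have hrep : ∀ p ∈ pts W, p ≠ p0 → ∃ b : F4, b ≠ 0 ∧ Fin.tail p.rep = b • Fin.tail x := by
      intro p hp hpp0
      have hpW := rep_mem_iff.2 hp
      rw [← eq_sup_of_mem_pts hW (Ne.symm hqp0) hp0 hqW, Submodule.mem_sup] at hpW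
      obtain ⟨y, hy, z, hz, hyz⟩ := hpW
      rw [submodule_mk, Submodule.mem_span_singleton] at hy
      rw [submodule_eq, Submodule.mem_span_singleton] at hz
      obtain ⟨c, rfl⟩ := hy
      obtain ⟨b, rfl⟩ := hz
      refine ⟨b, ?_, ?_⟩
      · rintro rfl
        refine hpp0 ?_
        rw [← mk_rep p]
        refine (mk_eq_mk_iff' F4 _ _ _ _).2 ⟨c, ?_⟩
        rw [← hyz, zero_smul, add_zero]
      · rw [← hyz]
        change c • (0 : Fin D → F4) + b • Fin.tail x = _
        rw [smul_zero, zero_add]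
    by_cases hx4 : Fin.tail x ∈ coneOver C4
    · have : (pts W).filter (fun p => p ∈ pointsOf S) = (pts W).erase p0 := by
        ext p
        rw [Finset.mem_filter, Finset.mem_erase]
        constructor
        · rintro ⟨h1, h2⟩
          exact ⟨fun h => hp0T (h ▸ h2), h1⟩
        · rintro ⟨h1, h2⟩
          obtain ⟨b, hb, hp⟩ := hrep p h2 h1
          refine ⟨h2, mem_pointsOf.2 (Or.inl ?_)⟩
          rw [hp]
          exact smul_mem_coneOver hb hx4
      rw [this, herase] at ha ⊢
      obtain rfl : a = 0 := by omega
      exact hasTable_4_0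
    by_cases hx3 : Fin.tail x ∈ coneOver C3
    · have hcons : (Fin.cons 0 (Fin.tail x) : Fin (D + 1) → F4) ≠ 0 := fun h =>
        hx0 (congrArg Fin.tail h)
      have hconsW : (Fin.cons 0 (Fin.tail x) : Fin (D + 1) → F4) ∈ W := by
        have h1 : (Fin.cons 1 0 : Fin (D + 1) → F4) ∈ W := (mk_mem_pts _).1 hp0
        have h2 := W.sub_mem (rep_mem_iff.2 hqW) (W.smul_mem (x 0) h1)
        convert h2 using 1
        rw [← sub_eq_zero]
        refine eq_zero_of_tail (by simp [← hx]) ?_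
        change Fin.tail x - (Fin.tail x - x 0 • (0 : Fin D → F4)) = 0
        rw [smul_zero, sub_zero, sub_self]
      let p1 := mk F4 _ hcons
      have hp1 : p1 ∈ (pts W).erase p0 := by
        refine Finset.mem_erase.2 ⟨fun h => ?_, (mk_mem_pts _).2 hconsW⟩
        obtain ⟨c, hc⟩ := (mk_eq_mk_iff' F4 _ _ _ _).1 h
        have h2 : c • (0 : Fin D → F4) = Fin.tail x := congrArg Fin.tail hc
        rw [smul_zero] at h2
        exact hx0 h2.symm
      have hp1T : p1 ∉ pointsOf S := by
        rw [mk_mem_pointsOf hSsmul]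
        rintro (h | ⟨h, -⟩)
        · exact hx4 h
        · exact h rfl
      have : (pts W).filter (fun p => p ∈ pointsOf S) = ((pts W).erase p0).erase p1 := by
        ext p
        rw [Finset.mem_filter, Finset.mem_erase, Finset.mem_erase]
        constructor
        · rintro ⟨h1, h2⟩
          exact ⟨fun h => hp1T (h ▸ h2), fun h => hp0T (h ▸ h2), h1⟩
        · rintro ⟨h1, h2, h3⟩
          obtain ⟨b, hb, hp⟩ := hrep p h3 h2
          refine ⟨h3, mem_pointsOf.2 (Or.inr ⟨fun h => h1 ?_, ?_⟩)⟩
          · rw [← mk_rep p]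
            refine (mk_eq_mk_iff' F4 _ _ _ _).2 ⟨b, ?_⟩
            rw [← sub_eq_zero]
            refine eq_zero_of_tail (by simp [h]) ?_
            change b • Fin.tail x - Fin.tail p.rep = 0
            rw [hp, sub_self]
          · rw [hp]
            exact smul_mem_coneOver hb hx3
      rw [this, Finset.card_erase_of_mem hp1, herase] at ha ⊢
      obtain rfl : a = 1 := by omega
      exact hasTable_3_1
    · have : (pts W).filter (fun p => p ∈ pointsOf S) = ∅ := by
        refine Finset.filter_eq_empty_iff.2 fun p hp hpT => ?_
        obtain ⟨b, hb, hp'⟩ := hrep p hp fun h => hp0T (h ▸ hpT)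
        have := mem_pointsOf.1 hpT
        simp only [S, hp', mem_coneOver_smul_iff hb] at this
        rcases this with h | ⟨-, h⟩
        · exact hx4 h
        · exact hx3 h
      rw [this, Finset.card_empty] at ha ⊢
      obtain rfl : a = 4 := by omega
      exact hasTable_0_4
  · have hZ : ((pts W).filter fun p => p ∈ ({p0} : Finset _)).card = 0 := by
      rw [Finset.card_eq_zero, Finset.filter_eq_empty_iff]
      intro p hp h
      exact hp0 (Finset.mem_singleton.1 h ▸ hp)
    rw [hZ] at ha
    generalize ((pts W).filter fun p => p ∈ pointsOf S).card = b at ha ⊢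
    obtain rfl : a = 5 - b := by omega
    have hb : b ≤ 5 := by omega
    interval_cases b
    · exact hasTable_0_5
    · exact hasTable_1_4
    · exact hasTable_2_3
    · exact hasTable_3_2
    · exact hasTable_4_1
    · exact hasTable_5_0

end Cones

/-! ### All orders -/

section Orders

open Projectivization Module
open scoped LinearAlgebra.Projectivization

theorem three_mul_bracket4 (D : ℕ) : 3 * bracket4 D + 1 = 4 ^ (D + 1) := by
  induction D with
  | zero => rfl
  | succ D ih =>
    rw [bracket4, Finset.sum_range_succ, ← bracket4, pow_succ 4 (D + 1), ← ih]
    have : 4 ^ (D + 1) = 3 * bracket4 D + 1 := ih.symm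
    omega

theorem bracket4_succ (D : ℕ) : bracket4 (D + 1) = 4 * bracket4 D + 1 := by
  have h1 := three_mul_bracket4 D
  have h2 := three_mul_bracket4 (D + 1)
  rw [pow_succ] at h2
  omega

theorem card_points (D : ℕ) :
    (Finset.univ : Finset (ℙ F4 (Fin (D + 1) → F4))).card = bracket4 D := by
  have h1 := card_univ_points (V := Fin (D + 1) → F4)
  rw [finrank_fin_fun] at h1
  have h2 := three_mul_bracket4 D
  omega

theorem hasDesign_bracket4_add_one_three_nine {D v : ℕ} (hD : 2 ≤ D)
    (hv : v = bracket4 D + 1 ∨ v = bracket4 D + 3 ∨ v = bracket4 D + 9) : HasDesign v 94 := by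
  have hV : 3 ≤ finrank F4 (Fin (D + 1) → F4) := by
    rw [finrank_fin_fun]; omega
  rcases hv with rfl | rfl | rfl
  · exact HasDesign.of_plane (k := 1) (by norm_num) hasTable_1_19 hV (by rw [card_points])
  · exact HasDesign.of_plane (k := 2) (by norm_num) hasTable_2_18 hV (by rw [card_points])
  · exact HasDesign.of_plane (k := 5) (by norm_num) hasTable_5_15 hV (by rw [card_points])

theorem hasDesign_bracket4_add_odd {D s : ℕ} (hs : 0 < s) (hs' : s ≤ 4 * bracket4 D)
    (h1 : s ≠ 1) (h2 : s ≠ 2) (h5 : s ≠ 5) : HasDesign (bracket4 (D + 1) + 2 * s - 1) 63 := by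
  obtain ⟨i, j, hij, rfl⟩ : ∃ i j, i + j ≤ bracket4 D ∧ s = 4 * i + 3 * j := by
    refine ⟨(s - 3 * ((4 - s % 4) % 4)) / 4, (4 - s % 4) % 4, ?_, ?_⟩ <;> omega
  refine HasDesign.of_cone (D := D + 1) (i := i) (j := j) ?_ ?_
  · rwa [card_points]
  · rw [card_points]; omega

theorem hasDesign_sixtyThree {v : ℕ} (hv : 0 < v) (h2 : v ≠ 2) (h6 : v ≠ 6) (h8 : v ≠ 8)
    (hexc : ∀ D, 3 ≤ D → v ≠ bracket4 D + 1 ∧ v ≠ bracket4 D + 3 ∧ v ≠ bracket4 D + 9) :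
    HasDesign v 63 := by
  obtain ⟨D, hD, hD'⟩ : ∃ D, bracket4 D ≤ v ∧ v < bracket4 (D + 1) := by
    have hlt : ∀ D, D < bracket4 D := by
      intro D
      induction D with
      | zero => decide
      | succ D ih => rw [bracket4_succ]; omega
    have hex : ∃ D, v < bracket4 D := ⟨v, hlt v⟩
    obtain ⟨E, hE⟩ : ∃ E, E = Nat.find hex := ⟨_, rfl⟩
    have hE' : v < bracket4 E := hE ▸ Nat.find_spec hex
    obtain - | E := E
    · simp [bracket4] at hE'
      omega
    · exact ⟨E, not_lt.1 (Nat.find_min hex (by omega)), hE'⟩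
  have hsucc := bracket4_succ D
  obtain - | D := D
  · have h0 : bracket4 0 = 1 := rfl
    have h1 : bracket4 1 = 5 := rfl
    obtain rfl | rfl | rfl : v = 1 ∨ v = 3 ∨ v = 4 := by omega
    · have := HasDesign.of_three (V := Fin 1 → F4) (s := 0) (Nat.zero_le _)
      rwa [card_points] at this
    · have := HasDesign.of_three (V := Fin 1 → F4) (s := 1) (by rw [card_points]; decide)
      rwa [card_points] at this
    · exact (hasNoThreeSecantSet 0 (z := 1) le_rfl).hasNoTwoSecantSet (v := 4) rfl |>.hasDesign
  have hsucc' := bracket4_succ D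
  by_cases hlarge : 3 * bracket4 (D + 1) + 1 ≤ v
  · refine (hasNoTwoSecantSet_of_le (D + 1) ?_ ?_).hasDesign
    · rwa [← three_mul_bracket4]
    · have := three_mul_bracket4 (D + 1 + 1)
      exact (by omega : 3 * v + 1 ≤ 3 * bracket4 (D + 1 + 1) + 1).trans_eq this
  by_cases hsub : v + 1 = 3 * bracket4 (D + 1)
  · obtain rfl : v = 4 ^ (D + 2) - 2 := by rw [← three_mul_bracket4]; omega
    exact (hasNoTwoSecantSet_sub_two D).hasDesign
  obtain ⟨k, hk⟩ : ∃ k, v = bracket4 (D + 1) + k := ⟨v - bracket4 (D + 1), by omega⟩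
  obtain ⟨s, hs | hs⟩ : ∃ s, k = 2 * s ∨ k + 1 = 2 * s := ⟨(k + 1) / 2, by omega⟩
  · have := HasDesign.of_three (V := Fin (D + 1 + 1) → F4) (s := s) (by rw [card_points]; omega)
    rwa [card_points, ← hs, ← hk] at this
  by_cases hs' : s = 1 ∨ s = 2 ∨ s = 5
  · have h139 : v = bracket4 (D + 1) + 1 ∨ v = bracket4 (D + 1) + 3 ∨
        v = bracket4 (D + 1) + 9 := by omega
    have hD2 : D + 1 = 1 ∨ D + 1 = 2 ∨ 3 ≤ D + 1 := by omega
    rcases hD2 with hD1 | hD2 | hD3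
    · obtain rfl : D = 0 := by omega
      have : bracket4 (0 + 1) = 5 := rfl
      omega
    · obtain rfl : D = 1 := by omega
      have h21 : bracket4 (1 + 1) = 21 := rfl
      exact (hasDesign_bracket4_add_one_three_nine le_rfl h139).self.mono (by omega)
    · have := hexc (D + 1) hD3
      omega
  · have := hasDesign_bracket4_add_odd (D := D) (s := s) (by omega) (by omega) (by omega)
      (by omega) (by omega)
    convert this using 1
    omega

end Orders

/-- For every `v ∉ {2,6,8}` there exists a `PBD(v,{3,4,5})` in which any three points lie in
a flat of size at most `63`, unless `v - [e]₄ ∈ {1,3,9}` for some `e ≥ 3`, in which case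
there exists one in which any three points lie in a flat of size at most `94`. -/
theorem statement1 (v : ℕ) (hv : 0 < v) (hv' : v ∉ ({2, 6, 8} : Set ℕ)) :
    (¬ (∃ e : ℕ, 3 ≤ e ∧ v - bracket4 e ∈ ({1, 3, 9} : Set ℕ)) →
      ∃ Blocks : Finset (Finset (Fin v)), IsPBD Finset.univ ({3, 4, 5} : Set ℕ) Blocks ∧
        ∀ S : Finset (Fin v), S.card = 3 →
          ∃ Y : Finset (Fin v), IsFlat Finset.univ Blocks Y ∧ S ⊆ Y ∧ Y.card ≤ 63) ∧
    ((∃ e : ℕ, 3 ≤ e ∧ v - bracket4 e ∈ ({1, 3, 9} : Set ℕ)) →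
      ∃ Blocks : Finset (Finset (Fin v)), IsPBD Finset.univ ({3, 4, 5} : Set ℕ) Blocks ∧
        ∀ S : Finset (Fin v), S.card = 3 →
          ∃ Y : Finset (Fin v), IsFlat Finset.univ Blocks Y ∧ S ⊆ Y ∧ Y.card ≤ 94) := by
  simp only [Set.mem_insert_iff, Set.mem_singleton_iff, not_or] at hv' ⊢
  constructor
  · intro h
    refine hasDesign_sixtyThree hv hv'.1 hv'.2.1 hv'.2.2 fun D hD => ?_
    have h' : ¬ (v - bracket4 D = 1 ∨ v - bracket4 D = 3 ∨ v - bracket4 D = 9) := fun h' =>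
      h ⟨D, hD, h'⟩
    omega
  · rintro ⟨e, he, h⟩
    exact hasDesign_bracket4_add_one_three_nine (D := e) (by omega) (by omega)
end

section
/- Given integers u ≥ k ≥ 4, there exists g₀ such that for all g ≥ g₀ and all i ∈ {0,1,...,u}, there exists a group divisible design of type gⁱ(g-1)^{u-i} (i groups of size g and u-i groups of size g-1) with block sizes in {k-2,k-1,k}; moreover, it can be chosen so that each group contains a point incident only with blocks of size k-1 and k. -/
/-- `IsGDD V grp K Blocks` : a group divisible design on point set `V`, where the group of
a point `x` is `grp x`; every block is a subset of `V` with size in `K` meeting each group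
at most once, and every pair of points of `V` from distinct groups lies in exactly one block. -/
def IsGDD {X ι : Type*} (V : Finset X) (grp : X → ι) (K : Set ℕ)
    (Blocks : Finset (Finset X)) : Prop :=
  (∀ B ∈ Blocks, B ⊆ V ∧ B.card ∈ K ∧ ∀ x ∈ B, ∀ y ∈ B, grp x = grp y → x = y) ∧
    ∀ x ∈ V, ∀ y ∈ V, grp x ≠ grp y → ∃! B, B ∈ Blocks ∧ x ∈ B ∧ y ∈ B

/-- A finite commutative ring of order divisible by a prescribed number, containing `u` elements
whose pairwise differences are units. -/
theorem exists_ring_isUnit_sub (u m : ℕ) (hm : m ≠ 0) :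
    ∃ (R : Type) (_ : CommRing R) (_ : Finite R) (c : Fin u → R),
      (∀ i j, i ≠ j → IsUnit (c i - c j)) ∧ m ∣ Nat.card R := by
  induction m using Nat.recOnMul with
  | zero => exact absurd rfl hm
  | one => exact ⟨PUnit, inferInstance, inferInstance, fun _ => 0,
      fun _ _ _ => isUnit_of_subsingleton _, one_dvd _⟩
  | prime p hp =>
    have := Fact.mk hp
    have hcard : Nat.card (GaloisField p (u + 1)) = p ^ (u + 1) :=
      GaloisField.card p (u + 1) u.succ_ne_zero
    have : Finite (GaloisField p (u + 1)) :=
      Nat.finite_of_card_ne_zero (by rw [hcard]; exact pow_ne_zero _ hp.ne_zero)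
    have := Fintype.ofFinite (GaloisField p (u + 1))
    have hle : Fintype.card (Fin u) ≤ Fintype.card (GaloisField p (u + 1)) := by
      rw [Fintype.card_fin, ← Nat.card_eq_fintype_card, hcard]
      exact u.le_succ.trans (Nat.lt_pow_self hp.one_lt).le
    obtain ⟨c⟩ := Function.Embedding.nonempty_of_card_le hle
    exact ⟨GaloisField p (u + 1), inferInstance, inferInstance, c,
      fun i j hij => (sub_ne_zero.2 (c.injective.ne hij)).isUnit,
      hcard ▸ dvd_pow_self p u.succ_ne_zero⟩
  | mul a b iha ihb =>
    obtain ⟨R, _, _, c, hc, hR⟩ := iha (left_ne_zero_of_mul hm)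
    obtain ⟨S, _, _, d, hd, hS⟩ := ihb (right_ne_zero_of_mul hm)
    exact ⟨R × S, inferInstance, inferInstance, fun i => (c i, d i),
      fun i j hij => Prod.isUnit_iff.2 ⟨hc i j hij, hd i j hij⟩,
      Nat.card_prod R S ▸ mul_dvd_mul hR hS⟩

/-- The number of `k`-subsets containing two given points. -/
theorem card_powersetCard_filter_mem_mem {α : Type*} [Fintype α] [DecidableEq α] {k : ℕ}
    (hk : 2 ≤ k) {i j : α} (hij : i ≠ j) :
    ((Finset.univ.powersetCard k).filter fun B : Finset α => i ∈ B ∧ j ∈ B).card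
      = (Fintype.card α - 2).choose (k - 2) := by
  have h2 : ({i, j} : Finset α).card = 2 := Finset.card_pair hij
  have hc : (Finset.univ \ {i, j} : Finset α).card = Fintype.card α - 2 := by
    rw [Finset.card_univ_sdiff, h2]
  rw [← hc, ← Finset.card_powersetCard]
  refine Finset.card_nbij' (fun B => B \ {i, j}) (fun B => B ∪ {i, j}) ?_ ?_ ?_ ?_
  · intro B hB
    simp only [Finset.coe_filter, Finset.mem_powersetCard_univ, Set.mem_ofPred_eq] at hB
    have hs : ({i, j} : Finset α) ⊆ B := by simp [Finset.insert_subset_iff, hB.2]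
    simp only [Finset.mem_coe, Finset.mem_powersetCard]
    exact ⟨Finset.sdiff_subset_sdiff (Finset.subset_univ _) subset_rfl, by
      rw [Finset.card_sdiff_of_subset hs, h2, hB.1]⟩
  · intro B hB
    simp only [Finset.mem_coe, Finset.mem_powersetCard] at hB
    have hd : Disjoint B {i, j} := Finset.disjoint_of_subset_left hB.1 Finset.sdiff_disjoint
    simp only [Finset.coe_filter, Finset.mem_powersetCard_univ, Set.mem_ofPred_eq,
      Finset.card_union_of_disjoint hd, h2, hB.2]
    exact ⟨by omega, by simp⟩
  · intro B hB
    simp only [Finset.coe_filter, Finset.mem_powersetCard_univ, Set.mem_ofPred_eq] at hB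
    exact Finset.sdiff_union_of_subset (by simp [Finset.insert_subset_iff, hB.2])
  · intro B hB
    simp only [Finset.mem_coe, Finset.mem_powersetCard] at hB
    have hd : Disjoint B {i, j} := Finset.disjoint_of_subset_left hB.1 Finset.sdiff_disjoint
    exact Finset.union_sdiff_cancel_right hd

/-- Any two coordinates of the array `φ` show every pair of symbols exactly once, where row `b`
is defined on the coordinates in `S b`. -/
def IsPartialOA {ι β G : Type*} (S : β → Finset ι) (φ : β → ι → G) : Prop :=
  ∀ i j, i ≠ j → ∀ v w, ∃! b, i ∈ S b ∧ j ∈ S b ∧ φ b i = v ∧ φ b j = w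

theorem existsUnique_add_mul_eq {R : Type*} [CommRing R] {a b : R} (h : IsUnit (a - b))
    (v w : R) : ∃! p : R × R, p.1 + a * p.2 = v ∧ p.1 + b * p.2 = w := by
  obtain ⟨r, hr⟩ := h.exists_left_inv
  refine ⟨(v - a * (r * (v - w)), r * (v - w)), ⟨by ring, ?_⟩, ?_⟩
  · linear_combination (w - v) * hr
  · rintro ⟨x, y⟩ ⟨hx, hy⟩
    simp only at hx hy
    have : y = r * (v - w) := by linear_combination (-y) * hr - r * hy + r * hx
    ext
    · simp only; rw [← this]; linear_combination hx
    · exact this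

theorem IsPartialOA.prod {ι β G R : Type*} [CommRing R] {S : β → Finset ι} {φ : β → ι → G}
    (h : IsPartialOA S φ) {c : ι → R} (hc : ∀ i j, i ≠ j → IsUnit (c i - c j)) :
    IsPartialOA (fun b : β × R × R => S b.1)
      (fun b i => (φ b.1 i, b.2.1 + c i * b.2.2)) := by
  rintro i j hij ⟨v, v'⟩ ⟨w, w'⟩
  obtain ⟨b, hb, hb'⟩ := h i j hij v w
  obtain ⟨p, hp, hp'⟩ := existsUnique_add_mul_eq (hc i j hij) v' w'
  refine ⟨(b, p), ⟨hb.1, hb.2.1, Prod.ext hb.2.2.1 hp.1, Prod.ext hb.2.2.2 hp.2⟩, ?_⟩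
  rintro ⟨d, q⟩ ⟨h1, h2, h3, h4⟩
  rw [Prod.mk.injEq] at h3 h4
  exact Prod.ext (hb' d ⟨h1, h2, h3.1, h4.1⟩) (hp' q ⟨h3.2, h4.2⟩)

/-- For `u ≥ k` there is a partial orthogonal array on `u` coordinates all of whose rows are
defined on exactly `k` coordinates. -/
theorem exists_isPartialOA {u k : ℕ} (hk : 2 ≤ k) (hu : k ≤ u) :
    ∃ (β G : Type) (_ : Finite β) (_ : Finite G) (_ : Nonempty G)
      (S : β → Finset (Fin u)) (φ : β → Fin u → G),
      (∀ b, (S b).card = k) ∧ IsPartialOA S φ := by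
  classical
  obtain ⟨R, _, _, c, hc, T, hT⟩ := exists_ring_isUnit_sub u ((u - 2).choose (k - 2))
    (Nat.choose_pos (by omega)).ne'
  have hσ : ∀ i j : Fin u, ∃ σ : Finset (Fin u) → Fin T → R, i < j →
      ∀ r, ∃! q : Finset (Fin u) × Fin T,
        q.1.card = k ∧ i ∈ q.1 ∧ j ∈ q.1 ∧ σ q.1 q.2 = r := by
    intro i j
    by_cases hij : i < j
    swap
    · exact ⟨fun _ _ => 0, fun h => absurd h hij⟩
    let F := (Finset.univ.powersetCard k).filter fun B : Finset (Fin u) => i ∈ B ∧ j ∈ B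
    have hF : ∀ B, B ∈ F ↔ B.card = k ∧ i ∈ B ∧ j ∈ B := by simp [F]
    have hcard : Nat.card (F × Fin T) = Nat.card R := by
      rw [hT, Nat.card_prod, Nat.card_fin, Nat.card_eq_fintype_card, Fintype.card_coe,
        card_powersetCard_filter_mem_mem hk hij.ne, Fintype.card_fin]
    obtain ⟨e⟩ := Finite.card_eq.1 hcard
    refine ⟨fun B t => if h : B ∈ F then e (⟨B, h⟩, t) else 0, fun _ r => ?_⟩
    refine ⟨((e.symm r).1.1, (e.symm r).2), ?_, ?_⟩
    · have h := (e.symm r).1.2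
      have h' := (hF _).1 h
      exact ⟨h'.1, h'.2.1, h'.2.2, by simp⟩
    · rintro ⟨B, t⟩ ⟨h1, h2, h3, h4⟩
      have h : B ∈ F := (hF B).2 ⟨h1, h2, h3⟩
      simp only [h, dif_pos] at h4
      rw [← h4]; simp
  choose σ hσ using hσ
  let E := Fin u × Fin u
  let d : Fin u → E → R := fun i e => c (if i = e.2 ∧ e.1 < e.2 then e.1 else i)
  let a : Finset (Fin u) → Fin T → Fin u → E → R :=
    fun B t i e => if i = e.1 then σ e.1 e.2 B t else 0
  have hd : ∀ i j, i < j → ∀ e : E, e ≠ (i, j) → IsUnit (d i e - d j e) := by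
    rintro i j hij ⟨e, f⟩ he
    apply hc
    have : ¬ (e = i ∧ f = j) := fun h => he (by rw [h.1, h.2])
    simp only
    split_ifs <;> grind
  have hd' : ∀ i j, i < j → d i (i, j) = d j (i, j) := by
    intro i j hij
    simp [d, hij, hij.ne]
  let β := {B : Finset (Fin u) // B.card = k} × Fin T × (E → R) × {y : E → R // ∑ e, y e = 0}
  let φ : β → Fin u → E → R :=
    fun b i e => b.2.2.1 e + d i e * b.2.2.2.1 e + a b.1.1 b.2.1 i e
  have := Fintype.ofFinite R
  refine ⟨β, E → R, inferInstance, inferInstance, inferInstance, fun b => b.1.1, φ,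
    fun b => b.1.2, ?_⟩
  intro i j hij v w
  wlog hlt : i < j generalizing i j v w
  · obtain ⟨b, hb, hb'⟩ := this j i hij.symm w v (lt_of_le_of_ne (not_lt.1 hlt) hij.symm)
    exact ⟨b, ⟨hb.2.1, hb.1, hb.2.2.2, hb.2.2.1⟩,
      fun b₁ h => hb' b₁ ⟨h.2.1, h.1, h.2.2.2, h.2.2.1⟩⟩
  have hsub : ∀ B t, a B t i (i, j) - a B t j (i, j) = σ i j B t := by
    intro B t
    simp [a, hij.symm]
  obtain ⟨⟨B, t⟩, ⟨hB, hiB, hjB, hval⟩, huniq⟩ := hσ i j hlt (v (i, j) - w (i, j))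
  have hinv : ∀ e : E, ∃ r, e ≠ (i, j) → r * (d i e - d j e) = 1 := by
    intro e
    by_cases he : e = (i, j)
    · exact ⟨0, fun h => absurd he h⟩
    · obtain ⟨r, hr⟩ := (hd i j hlt e he).exists_left_inv
      exact ⟨r, fun _ => hr⟩
  choose r hr using hinv
  let z : E → R := fun e => r e * (v e - w e - (a B t i e - a B t j e))
  let y : E → R := Function.update z (i, j) (-∑ e ∈ Finset.univ.erase (i, j), z e)
  have hy : ∀ e, e ≠ (i, j) → y e = z e := fun e he => Function.update_of_ne he _ _
  have hsum : ∑ e, y e = 0 := by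
    rw [← Finset.add_sum_erase _ _ (Finset.mem_univ (i, j)),
      Finset.sum_congr rfl fun e he => hy e (Finset.ne_of_mem_erase he)]
    simp only [y, Function.update_self, neg_add_cancel]
  let x : E → R := fun e => v e - d i e * y e - a B t i e
  refine ⟨(⟨B, hB⟩, t, x, ⟨y, hsum⟩), ⟨hiB, hjB, ?_, ?_⟩, ?_⟩
  · funext e
    simp only [φ, x]
    ring
  · funext e
    simp only [φ, x]
    by_cases he : e = (i, j)
    · subst he
      have := hsub B t
      linear_combination (-y (i, j)) * hd' i j hlt - this - hval
    · rw [hy e he]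
      simp only [z]
      linear_combination (-(v e - w e - (a B t i e - a B t j e))) * hr e he
  · rintro ⟨⟨B', hB'⟩, t', x', ⟨y', hy'⟩⟩ ⟨hi, hj, hv, hw⟩
    simp only [φ] at hi hj hv hw
    have hv' := fun e => congrFun hv e
    have hw' := fun e => congrFun hw e
    have hBt : (B', t') = (B, t) := by
      refine huniq _ ⟨hB', hi, hj, ?_⟩
      simp only
      rw [← hsub B' t']
      linear_combination hv' (i, j) - hw' (i, j) - y' (i, j) * hd' i j hlt
    rw [Prod.mk.injEq] at hBt
    obtain ⟨rfl, rfl⟩ := hBt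
    have hz : ∀ e, e ≠ (i, j) → y' e = z e := by
      intro e he
      simp only [z]
      linear_combination (-y' e) * hr e he + r e * (hv' e - hw' e)
    have hyy : y' = y := by
      funext e
      by_cases he : e = (i, j)
      · subst he
        rw [← Finset.add_sum_erase _ _ (Finset.mem_univ (i, j)),
          Finset.sum_congr rfl fun e he => hz e (Finset.ne_of_mem_erase he)] at hy'
        simp only [y, Function.update_self]
        linear_combination hy'
      · rw [hz e he, hy e he]
    have hxx : x' = x := by
      funext e
      simp only [x, ← hyy]
      linear_combination hv' e
    subst hyy
    rw [hxx]

theorem isUnit_natCast_sub_natCast_zmod (u t : ℕ) {i j : Fin u} (hij : i ≠ j) :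
    IsUnit (((i : ℕ) : ZMod (u.factorial * t + 1)) - ((j : ℕ) : ZMod (u.factorial * t + 1))) := by
  wlog h : j < i generalizing i j
  · have := this hij.symm (lt_of_le_of_ne (not_lt.1 h) hij)
    rw [← neg_sub]
    exact this.neg
  rw [← Nat.cast_sub (Fin.lt_def.1 h).le, ZMod.isUnit_iff_coprime]
  have h1 : (i : ℕ) - j ∣ u.factorial * t :=
    (Nat.dvd_factorial (by have := Fin.lt_def.1 h; omega) (by omega)).mul_right t
  exact Nat.Coprime.coprime_dvd_left h1 (by simp)

/-- The slope of two points `(a, a²)`, `(b, b²)` of a parabola is `a + b`. -/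
theorem eq_add_of_add_mul_eq_sq {R : Type*} [CommRing R] {a b x y : R} (h : IsUnit (a - b))
    (ha : x + a * y = a ^ 2) (hb : x + b * y = b ^ 2) : y = a + b := by
  refine h.mul_left_cancel ?_
  linear_combination ha - hb

/-- For infinitely many `M` there is a group divisible design of type `M ^ u` with blocks of
size `k` and a set `C` of points, meeting every group in a fixed proportion of its points, such
that no block meets `C` in more than two points. -/
theorem exists_uniform_design_with_arc {u k : ℕ} (hk : 2 ≤ k) (hu : k ≤ u) :
    ∃ A p : ℕ, 0 < A ∧ 0 < p ∧ ∀ t : ℕ, ∃ (X β : Type) (_ : Fintype X) (grp : X → Fin u)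
      (blk : β → Set X) (C : Set X), Finite β ∧
      (∀ b, (blk b).ncard = k) ∧
      (∀ b, ∀ x ∈ blk b, ∀ y ∈ blk b, grp x = grp y → x = y) ∧
      (∀ x y, grp x ≠ grp y → ∃! b, x ∈ blk b ∧ y ∈ blk b) ∧
      (∀ b, (blk b ∩ C).ncard ≤ 2) ∧
      (∀ j, {x | grp x = j}.ncard = A * p * (u.factorial * t + 1)) ∧
      ∀ j, {x | grp x = j ∧ x ∈ C}.ncard = A * (u.factorial * t + 1) := by
  classical
  obtain ⟨β, G, _, _, _, S, φ, hS, hφ⟩ := exists_isPartialOA hk hu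
  let P := ZMod (u.factorial * 1 + 1)
  refine ⟨Nat.card G, u.factorial * 1 + 1, Nat.card_pos, Nat.succ_pos _, fun t => ?_⟩
  let N := ZMod (u.factorial * t + 1)
  have : NeZero (u.factorial * 1 + 1) := ⟨Nat.succ_ne_zero _⟩
  have : NeZero (u.factorial * t + 1) := ⟨Nat.succ_ne_zero _⟩
  have : Nontrivial P := ZMod.nontrivial_iff.2 (by simp [u.factorial_ne_zero])
  have hP : Nat.card P = u.factorial * 1 + 1 := Nat.card_zmod _
  have hN : Nat.card N = u.factorial * t + 1 := Nat.card_zmod _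
  let c : Fin u → P × N := fun i => (((i : ℕ) : P), ((i : ℕ) : N))
  have hc1 : ∀ i j, i ≠ j → IsUnit ((c i).1 - (c j).1) := fun i j hij =>
    isUnit_natCast_sub_natCast_zmod u 1 hij
  have hc : ∀ i j, i ≠ j → IsUnit (c i - c j) := fun i j hij =>
    Prod.isUnit_iff.2 ⟨hc1 i j hij, isUnit_natCast_sub_natCast_zmod u t hij⟩
  have h := hφ.prod hc
  set ψ : β × (P × N) × (P × N) → Fin u → G × P × N :=
    fun b i => (φ b.1 i, b.2.1 + c i * b.2.2)
  let X := Fin u × G × P × N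
  let blk : β × (P × N) × (P × N) → Set X := fun b => (fun i => (i, ψ b i)) '' (S b.1 : Set (Fin u))
  have hblk : ∀ b (x : X), x ∈ blk b ↔ x.1 ∈ S b.1 ∧ ψ b x.1 = x.2 := by
    rintro b ⟨i, v⟩
    constructor
    · rintro ⟨j, hj, hj'⟩
      rw [Prod.mk.injEq] at hj'
      obtain ⟨rfl, rfl⟩ := hj'
      exact ⟨hj, rfl⟩
    · rintro ⟨h1, h2⟩
      exact ⟨i, h1, Prod.ext rfl h2⟩
  refine ⟨X, β × (P × N) × (P × N), Fintype.ofFinite X, Prod.fst, blk,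
    {x | x.2.2.1 = (c x.1).1 ^ 2}, inferInstance, ?_, ?_, ?_, ?_, ?_, ?_⟩
  · intro b
    rw [Set.ncard_image_of_injective _ fun i j hij => congrArg Prod.fst hij,
      Set.ncard_coe_finset, hS]
  · rintro b ⟨i, v⟩ hx ⟨j, w⟩ hy hij
    rw [hblk] at hx hy
    simp only at hij hx hy
    subst hij
    rw [← hx.2, ← hy.2]
  · rintro ⟨i, v⟩ ⟨j, w⟩ hij
    obtain ⟨b, hb, hb'⟩ := h i j hij v w
    refine ⟨b, ⟨(hblk _ _).2 ⟨hb.1, hb.2.2.1⟩, (hblk _ _).2 ⟨hb.2.1, hb.2.2.2⟩⟩, ?_⟩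
    rintro b' ⟨h1, h2⟩
    rw [hblk] at h1 h2
    exact hb' b' ⟨h1.1, h2.1, h1.2, h2.2⟩
  · intro b
    by_contra! hlt
    obtain ⟨x, y, z, ⟨hx, hxC⟩, ⟨hy, hyC⟩, ⟨hz, hzC⟩, hxy, hxz, hyz⟩ :=
      (Set.two_lt_ncard_iff (Set.toFinite _)).1 hlt
    rw [hblk] at hx hy hz
    have key : ∀ x : X, ψ b x.1 = x.2 → x.2.2.1 = (c x.1).1 ^ 2 →
        b.2.1.1 + (c x.1).1 * b.2.2.1 = (c x.1).1 ^ 2 := by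
      rintro x h1 h2
      rw [← h2, ← h1]
      simp [ψ]
    have hne : ∀ x y : X, ψ b x.1 = x.2 → ψ b y.1 = y.2 → x ≠ y → x.1 ≠ y.1 := by
      rintro x y h1 h2 hxy h3
      exact hxy (Prod.ext h3 (by rw [← h1, ← h2, h3]))
    have e1 := eq_add_of_add_mul_eq_sq (hc1 _ _ (hne x y hx.2 hy.2 hxy))
      (key x hx.2 hxC) (key y hy.2 hyC)
    have e2 := eq_add_of_add_mul_eq_sq (hc1 _ _ (hne x z hx.2 hz.2 hxz))
      (key x hx.2 hxC) (key z hz.2 hzC)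
    refine (hc1 _ _ (hne y z hy.2 hz.2 hyz)).ne_zero ?_
    linear_combination e2 - e1
  · intro j
    have : {x : X | x.1 = j} = {j} ×ˢ Set.univ :=
      Set.ext fun x => ⟨fun h => ⟨h, trivial⟩, fun h => h.1⟩
    rw [this, Set.ncard_prod, Set.ncard_singleton, Set.ncard_univ, Nat.card_prod, Nat.card_prod,
      hP, hN]
    ring
  · intro j
    have : {x : X | x.1 = j ∧ x ∈ {x : X | x.2.2.1 = (c x.1).1 ^ 2}} =
        {j} ×ˢ Set.univ ×ˢ {(c j).1 ^ 2} ×ˢ Set.univ := by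
      ext ⟨i, v, r, s⟩
      constructor
      · rintro ⟨rfl, h⟩; exact ⟨rfl, trivial, h, trivial⟩
      · rintro ⟨rfl, -, h, -⟩; exact ⟨rfl, h⟩
    rw [this, Set.ncard_prod, Set.ncard_prod, Set.ncard_prod, Set.ncard_singleton,
      Set.ncard_singleton, Set.ncard_univ, Set.ncard_univ, hN]
    ring

/-- Deleting points of a set that meets every block at most twice. -/
theorem exists_isGDD_of_delete {u k : ℕ} (hk : 4 ≤ k) {X β : Type} [Fintype X] [Finite β]
    {grp : X → Fin u} {blk : β → Set X} {C : Set X}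
    (hcard : ∀ b, (blk b).ncard = k)
    (hinj : ∀ b, ∀ x ∈ blk b, ∀ y ∈ blk b, grp x = grp y → x = y)
    (huniq : ∀ x y, grp x ≠ grp y → ∃! b, x ∈ blk b ∧ y ∈ blk b)
    (hC : ∀ b, (blk b ∩ C).ncard ≤ 2) (s : Fin u → ℕ)
    (hs : ∀ j, s j ≤ {x | grp x = j}.ncard)
    (hs' : ∀ j, {x | grp x = j}.ncard < s j + {x | grp x = j ∧ x ∈ C}.ncard) :
    ∃ (n : ℕ) (grp' : Fin n → Fin u) (Blocks : Finset (Finset (Fin n))),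
      IsGDD Finset.univ grp' ({k - 2, k - 1, k} : Set ℕ) Blocks ∧
        (∀ j, (Finset.univ.filter fun x => grp' x = j).card = s j) ∧
        ∀ j : Fin u, ∃ x : Fin n, grp' x = j ∧
          ∀ B ∈ Blocks, x ∈ B → B.card = k - 1 ∨ B.card = k := by
  classical
  have := Fintype.ofFinite β
  have hW : ∀ j, ∃ (q : X) (W : Set X), grp q = j ∧ q ∈ C ∧ q ∈ W ∧ W ⊆ {x | grp x = j} ∧
      {x | grp x = j} \ W ⊆ C ∧ W.ncard = s j := by
    intro j
    have hsplit : {x | grp x = j ∧ x ∈ C}.ncard + ({x | grp x = j} \ C).ncard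
        = {x | grp x = j}.ncard := Set.ncard_inter_add_ncard_sdiff_eq_ncard _ _
    have hj := hs j
    have hj' := hs' j
    have hne : {x | grp x = j ∧ x ∈ C}.ncard ≠ 0 := by omega
    obtain ⟨q, hq, hqC⟩ := Set.nonempty_of_ncard_ne_zero hne
    have hsub : insert q ({x | grp x = j} \ C) ⊆ {x | grp x = j} :=
      Set.insert_subset hq Set.sdiff_subset
    have hle := Set.ncard_insert_le q ({x | grp x = j} \ C)
    obtain ⟨W, h1, h2, h3⟩ := Set.exists_subsuperset_card_eq hsub
      (show _ ≤ s j by omega) hj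
    refine ⟨q, W, hq, hqC, h1 (Set.mem_insert _ _), h2, ?_, h3⟩
    rintro x ⟨hx, hxW⟩
    by_contra hxC
    exact hxW (h1 (Set.mem_insert_of_mem _ ⟨hx, hxC⟩))
  choose q W hq hqC hqW hWs hWC hWcard using hW
  let V := {x : X // x ∈ W (grp x)}
  let e : V ≃ Fin (Fintype.card V) := Fintype.equivFin V
  let p : Fin (Fintype.card V) → X := fun z => (e.symm z).1
  have hp : Function.Injective p := Subtype.val_injective.comp e.symm.injective
  have hrange : ∀ x, x ∈ Set.range p ↔ x ∈ W (grp x) := by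
    intro x
    constructor
    · rintro ⟨z, rfl⟩; exact (e.symm z).2
    · intro hx; exact ⟨e ⟨x, hx⟩, by simp [p]⟩
  have hdel : ∀ x, x ∉ Set.range p → x ∈ C := fun x hx =>
    hWC (grp x) ⟨rfl, fun h => hx ((hrange x).2 h)⟩
  let tr : β → Finset (Fin (Fintype.card V)) := fun b => Finset.univ.filter fun z => p z ∈ blk b
  have htr : ∀ b z, z ∈ tr b ↔ p z ∈ blk b := by simp [tr]
  have htrcard : ∀ b, (tr b).card + (blk b \ Set.range p).ncard = k := by
    intro b
    rw [← hcard b, ← Set.ncard_inter_add_ncard_sdiff_eq_ncard (blk b) (Set.range p),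
      ← Set.ncard_coe_finset, ← Set.ncard_image_of_injective _ hp]
    congr 2
    ext x
    constructor
    · rintro ⟨z, hz, rfl⟩; exact ⟨(htr b z).1 hz, z, rfl⟩
    · rintro ⟨hx, z, rfl⟩; exact ⟨z, (htr b z).2 hx, rfl⟩
  have hdelsub : ∀ b, blk b \ Set.range p ⊆ blk b ∩ C := fun b x hx => ⟨hx.1, hdel x hx.2⟩
  refine ⟨Fintype.card V, fun z => grp (p z), Finset.univ.image tr, ⟨?_, ?_⟩, ?_, ?_⟩
  · intro B hB
    obtain ⟨b, -, rfl⟩ := Finset.mem_image.1 hB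
    refine ⟨Finset.subset_univ _, ?_, ?_⟩
    · have h1 := htrcard b
      have h2 := (Set.ncard_le_ncard (hdelsub b)).trans (hC b)
      simp only [Set.mem_insert_iff, Set.mem_singleton_iff]
      omega
    · intro x hx y hy hxy
      exact hp (hinj b _ ((htr b x).1 hx) _ ((htr b y).1 hy) hxy)
  · intro x _ y _ hxy
    obtain ⟨b, hb, hb'⟩ := huniq _ _ hxy
    refine ⟨tr b, ⟨Finset.mem_image_of_mem _ (Finset.mem_univ _), (htr b x).2 hb.1,
      (htr b y).2 hb.2⟩, ?_⟩
    rintro B ⟨hB, hx, hy⟩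
    obtain ⟨b', -, rfl⟩ := Finset.mem_image.1 hB
    rw [hb' b' ⟨(htr b' x).1 hx, (htr b' y).1 hy⟩]
  · intro j
    rw [← hWcard j, ← Set.ncard_coe_finset, ← Set.ncard_image_of_injective _ hp]
    congr 1
    ext x
    constructor
    · rintro ⟨z, hz, rfl⟩
      have hz : grp (p z) = j := by simpa using hz
      have := (hrange (p z)).1 ⟨z, rfl⟩
      rwa [hz] at this
    · intro hx
      have hj : grp x = j := hWs j hx
      obtain ⟨z, rfl⟩ := (hrange x).2 (by rwa [hj])
      exact ⟨z, by simpa using hj, rfl⟩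
  · intro j
    obtain ⟨z, hz⟩ := (hrange (q j)).2 (by rw [hq j]; exact hqW j)
    refine ⟨z, (congrArg grp hz).trans (hq j), ?_⟩
    intro B hB hzB
    obtain ⟨b, -, rfl⟩ := Finset.mem_image.1 hB
    have hqb : q j ∈ blk b := hz ▸ (htr b z).1 hzB
    have hsub : insert (q j) (blk b \ Set.range p) ⊆ blk b ∩ C :=
      Set.insert_subset ⟨hqb, hqC j⟩ (hdelsub b)
    have hnot : q j ∉ blk b \ Set.range p := fun h => h.2 ⟨z, hz⟩
    have h1 := htrcard b
    have h2 := (Set.ncard_le_ncard hsub).trans (hC b)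
    rw [Set.ncard_insert_of_notMem hnot] at h2
    omega

theorem map_ite_val_lt_univ_fin {α : Type*} (u i : ℕ) (hi : i ≤ u) (a b : α) :
    (Finset.univ.val.map fun j : Fin u => if (j : ℕ) < i then a else b)
      = Multiset.replicate i a + Multiset.replicate (u - i) b := by
  obtain ⟨m, rfl⟩ := Nat.exists_eq_add_of_le hi
  rw [Fin.univ_val_map, List.ofFn_add]
  simp [List.ofFn_const, ← Multiset.coe_add, ← Multiset.coe_replicate]

/-- Given `u ≥ k ≥ 4`, for all sufficiently large `g` and all `i ∈ {0,…,u}` there is a GDD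
of type `gⁱ(g-1)^{u-i}` with block sizes in `{k-2, k-1, k}`, which moreover can be chosen
so that each group contains a point lying only in blocks of size `k-1` or `k`. -/
theorem statement7 (u k : ℕ) (hk : 4 ≤ k) (hu : k ≤ u) :
    ∃ g₀ : ℕ, ∀ g : ℕ, g₀ ≤ g → ∀ i : ℕ, i ≤ u →
      ∃ (n : ℕ) (grp : Fin n → Fin u) (Blocks : Finset (Finset (Fin n))),
        IsGDD Finset.univ grp ({k - 2, k - 1, k} : Set ℕ) Blocks ∧
          (Finset.univ.val.map fun j => (Finset.univ.filter fun x => grp x = j).card)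
              = Multiset.replicate i g + Multiset.replicate (u - i) (g - 1) ∧
          ∀ j : Fin u, ∃ x : Fin n, grp x = j ∧
            ∀ B ∈ Blocks, x ∈ B → B.card = k - 1 ∨ B.card = k := by
  obtain ⟨A, p, hA, hp, hdesign⟩ := exists_uniform_design_with_arc (by omega : 2 ≤ k) hu
  set f := u.factorial
  have hf0 : 0 < f := u.factorial_pos
  have hq : 0 < A * p * f := by positivity
  refine ⟨A * p * f * (p * (f + 1) + 2), fun g hg i hi => ?_⟩
  set t := g / (A * p * f) + 1 with ht
  obtain ⟨X, β, _, grp, blk, C, _, h1, h2, h3, h4, h5, h6⟩ := hdesign t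
  have hlow : g ≤ A * p * (f * t + 1) := by
    have := Nat.lt_mul_div_succ g hq
    rw [← ht] at this
    nlinarith
  have hupp : A * p * (f * t + 1) ≤ g + A * (p * (f + 1)) := by
    have := Nat.mul_div_le g (A * p * f)
    have e : A * p * (f * t + 1) = A * p * f * (g / (A * p * f)) + A * (p * (f + 1)) := by
      rw [ht]; ring
    omega
  have hN : A * (p * (f + 1)) + 2 ≤ A * (f * t + 1) := by
    have : p * (f + 1) + 2 ≤ t :=
      ((Nat.le_div_iff_mul_le hq).2 (by rwa [mul_comm])).trans (Nat.le_succ _)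
    have : p * (f + 1) + 2 ≤ f * t + 1 := by nlinarith
    calc A * (p * (f + 1)) + 2 ≤ A * (p * (f + 1) + 2) := by nlinarith
      _ ≤ _ := Nat.mul_le_mul_left _ this
  obtain ⟨n, grp', Blocks, hG, hsize, hpt⟩ := exists_isGDD_of_delete hk h1 h2 h3 h4
    (fun j => if (j : ℕ) < i then g else g - 1)
    (fun j => by rw [h5]; split_ifs <;> omega)
    (fun j => by rw [h5, h6]; split_ifs <;> omega)
  refine ⟨n, grp', Blocks, hG, ?_, hpt⟩
  rw [← map_ite_val_lt_univ_fin u i hi]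
  exact Multiset.map_congr rfl fun j _ => hsize j
end
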